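/- One-point upper tail with Tracy–Widom exponent: there exist universal constants c, C, N₀ > 0 such that for any N ≥ N₀, λ ∈ (0,N), R ∈ [0, H_λ²], interval I ⊆ ⟦-N,N⟧ with |I| ≥ H_λ², boundary conditions u, v ≤ A·H_λ with A > 0, and any t ∈ I: P^{λ;u,v}_{I;0}(X(t) > (R+A)·H_λ) ≤ C·exp(-c·R^{3/2}). -/

import Mathlib

open MeasureTheory Real
open scoped ENNReal

noncomputable section

/-- The full trajectory over `⟦0, n+1⟧` of a bridge with boundary values `u, v`
and interior values `q`. -/
def pathOf (u v : ℝ) (n : ℕ) (q : Fin n → ℝ) : ℕ → ℝ :=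
  fun t => if h : 1 ≤ t ∧ t ≤ n then q ⟨t - 1, by omega⟩ else if t = 0 then u else v

/-- Unnormalized density of a random walk bridge on `⟦0, n+1⟧` from `u` to `v`,
with increment Hamiltonian `H`: the product of `exp(-H(increment))` over all steps. -/
def bridgeDensity (H : ℝ → ℝ) (u v : ℝ) (n : ℕ) (q : Fin n → ℝ) : ℝ :=
  ∏ j ∈ Finset.range (n + 1),
    Real.exp (-(H (pathOf u v n q (j + 1) - pathOf u v n q j)))

/-- The (unnormalized) law of the interior points of a random walk bridge. -/
def bridgeMeasure (H : ℝ → ℝ) (u v : ℝ) (n : ℕ) : Measure (Fin n → ℝ) :=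
  volume.withDensity fun q => ENNReal.ofReal (bridgeDensity H u v n q)

open scoped Classical in
/-- The (unnormalized) law of a random walk bridge on `⟦0, n+1⟧` from `u` to `v`
constrained to stay above the floor in the interior, with area tilt
`exp(-c · Σ_j (X(j) - floor(j)))`. -/
def tiltedMeasure (H : ℝ → ℝ) (u v : ℝ) (n : ℕ) (c : ℝ) (floor : ℕ → ℝ) :
    Measure (Fin n → ℝ) :=
  volume.withDensity fun q =>
    ENNReal.ofReal (bridgeDensity H u v n q
      * Real.exp (-(c * ∑ j ∈ Finset.range (n + 1), (pathOf u v n q j - floor j)))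
      * if ∀ t, 1 ≤ t → t ≤ n → floor t ≤ pathOf u v n q t then 1 else 0)

/-- Probability of an event under the normalization of a finite measure. -/
def probOf {α : Type*} [MeasurableSpace α] (μ : Measure α) (E : Set α) : ℝ≥0∞ :=
  μ E / μ Set.univ

/-- The normalized (probability) version of a measure. -/
def normalizeMeasure {α : Type*} [MeasurableSpace α] (μ : Measure α) : Measure α :=
  (μ Set.univ)⁻¹ • μ

/-- Fluctuation scale `H_λ = λ^{-1/3} N^{1/3}`. -/
def Hlam (lam N : ℝ) : ℝ := lam ^ (-(1 : ℝ) / 3) * N ^ ((1 : ℝ) / 3)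

/-- Assumptions on the random walk Hamiltonian: convexity (log-concavity of the
increment density), zero mean, positive finite variance, and finite exponential
moments near zero. -/
structure RWAssumptions (H : ℝ → ℝ) : Prop where
  convex : ConvexOn ℝ Set.univ H
  integrable_exp : Integrable fun x : ℝ => Real.exp (-(H x))
  norm_pos : 0 < ∫ x : ℝ, Real.exp (-(H x))
  mean_zero : (∫ x : ℝ, x * Real.exp (-(H x))) = 0
  integrable_sq : Integrable fun x : ℝ => x ^ 2 * Real.exp (-(H x))
  var_pos : 0 < ∫ x : ℝ, x ^ 2 * Real.exp (-(H x))
  mgf : ∃ t₀ > 0, ∀ t : ℝ, |t| ≤ t₀ →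
    Integrable fun x : ℝ => Real.exp (t * x) * Real.exp (-(H x))

end

lemma ENNReal.rearrangement {a b c d : ℝ≥0∞} (hab : a ≤ b) (hcd : c ≤ d) :
    a * d + b * c ≤ a * c + b * d := by
  obtain ⟨e, rfl⟩ := exists_add_of_le hab
  obtain ⟨f, rfl⟩ := exists_add_of_le hcd
  calc a * (c + f) + (a + e) * c ≤ a * (c + f) + (a + e) * c + e * f := le_self_add
    _ = a * c + (a + e) * (c + f) := by ring

/-- The likelihood ratio order between densities: `F / G` is nonincreasing. -/
def LRLe (F G : ℝ → ℝ≥0∞) : Prop := ∀ x y, x ≤ y → F y * G x ≤ F x * G y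

/-- The convolution operator with kernel `p`. -/
noncomputable def convOp (p : ℝ → ℝ≥0∞) (f : ℝ → ℝ≥0∞) (y : ℝ) : ℝ≥0∞ := ∫⁻ x, p (y - x) * f x

lemma measurable_convOp {p f : ℝ → ℝ≥0∞} (hp : Measurable p) (hf : Measurable f) :
    Measurable (convOp p f) := by
  unfold convOp
  apply Measurable.lintegral_prod_right'
    (f := fun z : ℝ × ℝ => p (z.1 - z.2) * f z.2)
  fun_prop

lemma LRLe.mul {F G F' G' : ℝ → ℝ≥0∞} (h : LRLe F G) (h' : LRLe F' G') :
    LRLe (fun x => F x * F' x) (fun x => G x * G' x) := by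
  intro x y hxy
  calc F y * F' y * (G x * G' x) = (F y * G x) * (F' y * G' x) := by ring
    _ ≤ (F x * G y) * (F' x * G' y) := mul_le_mul' (h x y hxy) (h' x y hxy)
    _ = _ := by ring

/-- Total positivity of order two of the convolution kernel preserves the likelihood ratio order. -/
lemma LRLe.conv {p F G : ℝ → ℝ≥0∞} (hp : Measurable p) (hF : Measurable F) (hG : Measurable G)
    (htp : ∀ x y s t, x ≤ y → s ≤ t → p (y - s) * p (x - t) ≤ p (x - s) * p (y - t))
    (h : LRLe F G) : LRLe (convOp p F) (convOp p G) := by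
  intro x y hxy
  have key : ∀ a b : ℝ, convOp p F a * convOp p G b
      = ∫⁻ s, ∫⁻ t, (p (a - s) * F s) * (p (b - t) * G t) := by
    intro a b
    unfold convOp
    rw [← lintegral_mul_const _ (by fun_prop)]
    refine lintegral_congr fun s => ?_
    rw [lintegral_const_mul _ (by fun_prop)]
  have key' : ∀ a b : ℝ, convOp p F a * convOp p G b
      = ∫⁻ s, ∫⁻ t, (p (a - t) * F t) * (p (b - s) * G s) := by
    intro a b
    rw [key, lintegral_lintegral_swap]
    fun_prop
  have dbl : ∀ a b : ℝ, 2 * (convOp p F a * convOp p G b)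
      = ∫⁻ s, ∫⁻ t, ((p (a - s) * F s) * (p (b - t) * G t)
        + (p (a - t) * F t) * (p (b - s) * G s)) := by
    intro a b
    have hm : ∀ s, (∫⁻ t, ((p (a - s) * F s) * (p (b - t) * G t)
        + (p (a - t) * F t) * (p (b - s) * G s)))
        = (∫⁻ t, (p (a - s) * F s) * (p (b - t) * G t))
          + ∫⁻ t, (p (a - t) * F t) * (p (b - s) * G s) := by
      intro s
      rw [lintegral_add_left (by fun_prop)]
    simp_rw [hm]
    rw [lintegral_add_left, ← key, ← key', two_mul]
    apply Measurable.lintegral_prod_right'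
      (f := fun z : ℝ × ℝ => (p (a - z.1) * F z.1) * (p (b - z.2) * G z.2))
    fun_prop
  have h2 : 2 * (convOp p F y * convOp p G x) ≤ 2 * (convOp p F x * convOp p G y) := by
    rw [dbl, dbl]
    refine lintegral_mono fun s => lintegral_mono fun t => ?_
    have main : ∀ s t : ℝ, s ≤ t → (p (y - s) * F s) * (p (x - t) * G t)
        + (p (y - t) * F t) * (p (x - s) * G s) ≤ (p (x - s) * F s) * (p (y - t) * G t)
        + (p (x - t) * F t) * (p (y - s) * G s) := by
      intro s t hst
      have h1 := htp x y s t hxy hst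
      have h2 := h s t hst
      calc _ = (p (y - s) * p (x - t)) * (F s * G t) + (p (x - s) * p (y - t)) * (F t * G s) := by
            ring
        _ ≤ (p (y - s) * p (x - t)) * (F t * G s) + (p (x - s) * p (y - t)) * (F s * G t) :=
            ENNReal.rearrangement h1 h2
        _ = _ := by ring
    rcases le_total s t with hst | hst
    · exact main s t hst
    · calc _ = _ := add_comm _ _
        _ ≤ _ := main t s hst
        _ = _ := add_comm _ _
  exact (ENNReal.mul_le_mul_iff_right (by norm_num) (by norm_num)).1 h2

lemma LRLe.trans_of_pos {F G K : ℝ → ℝ≥0∞} (hFG : LRLe F G) (hGK : LRLe G K)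
    (h0 : ∀ x y, x ≤ y → K x ≠ 0 → G x ≠ 0 ∧ G y ≠ 0 ∧ G x ≠ ∞ ∧ G y ≠ ∞) : LRLe F K := by
  intro x y hxy
  by_cases hK : K x = 0
  · simp [hK]
  obtain ⟨hx, hy, hx', hy'⟩ := h0 x y hxy hK
  have := mul_le_mul' (hFG x y hxy) (hGK x y hxy)
  refine (ENNReal.mul_le_mul_iff_right (a := G x * G y) (mul_ne_zero hx hy)
    (ENNReal.mul_ne_top hx' hy')).1 ?_
  calc _ = F y * G x * (G y * K x) := by ring
    _ ≤ _ := this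
    _ = _ := by ring

lemma LRLe.setLIntegral_le {F G : ℝ → ℝ≥0∞} (hF : Measurable F) (hG : Measurable G)
    (h : LRLe F G) (a : ℝ) {b : ℝ≥0∞} (hb : ∫⁻ x in Set.Ioi a, G x ≤ b * ∫⁻ x in Set.Iic a, G x)
    (h0 : ∫⁻ x in Set.Iic a, G x ≠ 0) (htop : ∫⁻ x in Set.Iic a, G x ≠ ∞) :
    ∫⁻ x in Set.Ioi a, F x ≤ b * ∫⁻ x, F x := by
  have h1 : (∫⁻ x in Set.Ioi a, F x) * (∫⁻ x in Set.Iic a, G x)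
      ≤ (∫⁻ x in Set.Iic a, F x) * (∫⁻ x in Set.Ioi a, G x) := by
    rw [mul_comm (∫⁻ x in Set.Iic a, F x), ← lintegral_mul_const _ hF, ← lintegral_mul_const _ hG]
    refine setLIntegral_mono' measurableSet_Ioi fun y hy => ?_
    rw [← lintegral_const_mul _ hF, ← lintegral_const_mul _ hG]
    refine setLIntegral_mono' measurableSet_Iic fun x hx => ?_
    rw [mul_comm (G y)]
    exact h x y (le_trans hx (le_of_lt hy))
  refine (ENNReal.mul_le_mul_iff_left h0 htop).1 (h1.trans ?_)
  calc (∫⁻ x in Set.Iic a, F x) * (∫⁻ x in Set.Ioi a, G x)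
      ≤ (∫⁻ x, F x) * (b * ∫⁻ x in Set.Iic a, G x) :=
        mul_le_mul' (setLIntegral_le_lintegral _ _) hb
    _ = _ := by ring

/-- Weight of the trajectory `u, q 0, …, q (n - 1), z` with transition kernel `p` and site
weight `w`. -/
noncomputable def chainWeight (p w : ℝ → ℝ≥0∞) (z : ℝ) : (n : ℕ) → ℝ → (Fin n → ℝ) → ℝ≥0∞
  | 0, u, _ => p (z - u)
  | n + 1, u, q => p (q 0 - u) * (w (q 0) * chainWeight p w z n (q 0) fun i => q i.succ)

/-- Total weight of the trajectories from `x` to `z` with `n` interior points. -/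
noncomputable def chainMass (p w : ℝ → ℝ≥0∞) (z : ℝ) : ℕ → ℝ → ℝ≥0∞
  | 0, x => p (z - x)
  | n + 1, x => ∫⁻ y, p (y - x) * (w y * chainMass p w z n y)

lemma measurable_chainWeight {p w : ℝ → ℝ≥0∞} (hp : Measurable p) (hw : Measurable w) (z : ℝ)
    (n : ℕ) : Measurable fun a : ℝ × (Fin n → ℝ) => chainWeight p w z n a.1 a.2 := by
  induction n with
  | zero => simp only [chainWeight]; fun_prop
  | succ n ih =>
    simp only [chainWeight]
    have : Measurable fun a : ℝ × (Fin (n + 1) → ℝ) =>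
        chainWeight p w z n (a.2 0) fun i => a.2 i.succ :=
      Measurable.comp (g := fun a : ℝ × (Fin n → ℝ) => chainWeight p w z n a.1 a.2)
        (f := fun a : ℝ × (Fin (n + 1) → ℝ) => (a.2 0, fun i : Fin n => a.2 i.succ)) ih
        (by fun_prop)
    fun_prop

lemma measurable_chainWeight_right {p w : ℝ → ℝ≥0∞} (hp : Measurable p) (hw : Measurable w)
    (z : ℝ) (n : ℕ) (x : ℝ) : Measurable fun q : Fin n → ℝ => chainWeight p w z n x q :=
  (measurable_chainWeight hp hw z n).comp (measurable_prodMk_left (x := x))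

lemma measurable_chainMass {p w : ℝ → ℝ≥0∞} (hp : Measurable p) (hw : Measurable w) (z : ℝ)
    (n : ℕ) : Measurable (chainMass p w z n) := by
  induction n with
  | zero =>
    change Measurable fun x => p (z - x)
    fun_prop
  | succ n ih =>
    change Measurable fun x => ∫⁻ y, p (y - x) * (w y * chainMass p w z n y)
    apply Measurable.lintegral_prod_right'
      (f := fun a : ℝ × ℝ => p (a.2 - a.1) * (w a.2 * chainMass p w z n a.2))
    fun_prop

lemma lintegral_fin_succ {n : ℕ} {f : (Fin (n + 1) → ℝ) → ℝ≥0∞} (hf : Measurable f) :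
    ∫⁻ q, f q = ∫⁻ x : ℝ, ∫⁻ q : Fin n → ℝ, f (Fin.cons x q) := by
  have h := (volume_preserving_piFinSuccAbove (fun _ : Fin (n + 1) => ℝ) 0).symm
  rw [← h.lintegral_comp hf, Measure.volume_eq_prod, lintegral_prod]
  · simp [MeasurableEquiv.piFinSuccAbove, Fin.consEquiv]
  · exact (hf.comp h.measurable).aemeasurable

lemma lintegral_chainWeight {p w : ℝ → ℝ≥0∞} (hp : Measurable p) (hw : Measurable w) (z : ℝ)
    (n : ℕ) (x : ℝ) : ∫⁻ q, chainWeight p w z n x q = chainMass p w z n x := by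
  induction n generalizing x with
  | zero => simp [chainWeight, chainMass, volume_pi]
  | succ n ih =>
    rw [lintegral_fin_succ (measurable_chainWeight_right hp hw z (n + 1) x)]
    simp only [chainWeight, chainMass, Fin.cons_zero, Fin.cons_succ]
    refine lintegral_congr fun y => ?_
    have hm := measurable_chainWeight_right hp hw z n y
    rw [lintegral_const_mul _ (by fun_prop), lintegral_const_mul _ hm, ih]

/-- Total weight of the trajectories from `x` whose `i`-th interior point exceeds `a`. -/
noncomputable def chainTail (p w : ℝ → ℝ≥0∞) (z a : ℝ) (n : ℕ) (i : Fin n) (x : ℝ) : ℝ≥0∞ :=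
  ∫⁻ q, (Set.Ioi a).indicator 1 (q i) * chainWeight p w z n x q

lemma measurable_indicator_Ioi (a : ℝ) :
    Measurable ((Set.Ioi a).indicator (1 : ℝ → ℝ≥0∞)) :=
  measurable_one.indicator measurableSet_Ioi

lemma measurable_chainTail {p w : ℝ → ℝ≥0∞} (hp : Measurable p) (hw : Measurable w) (z a : ℝ)
    (n : ℕ) (i : Fin n) : Measurable (chainTail p w z a n i) := by
  have h1 := measurable_indicator_Ioi a
  have h2 := measurable_chainWeight hp hw z n
  unfold chainTail
  apply Measurable.lintegral_prod_right' (f := fun b : ℝ × (Fin n → ℝ) =>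
    (Set.Ioi a).indicator 1 (b.2 i) * chainWeight p w z n b.1 b.2)
  exact (h1.comp (by fun_prop)).mul h2

lemma chainTail_zero {p w : ℝ → ℝ≥0∞} (hp : Measurable p) (hw : Measurable w) (z a : ℝ)
    (n : ℕ) (x : ℝ) : chainTail p w z a (n + 1) 0 x
      = ∫⁻ y, p (y - x) * (w y * ((Set.Ioi a).indicator 1 y * chainMass p w z n y)) := by
  have h1 := measurable_indicator_Ioi a
  have h2 := measurable_chainWeight_right hp hw z (n + 1) x
  unfold chainTail
  have h3 : Measurable fun q : Fin (n + 1) → ℝ =>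
      (Set.Ioi a).indicator (1 : ℝ → ℝ≥0∞) (q 0) * chainWeight p w z (n + 1) x q :=
    (h1.comp (measurable_pi_apply 0)).mul h2
  rw [lintegral_fin_succ h3]
  simp only [chainWeight, Fin.cons_zero, Fin.cons_succ]
  refine lintegral_congr fun y => ?_
  have hm := measurable_chainWeight_right hp hw z n y
  rw [lintegral_const_mul _ (by fun_prop), lintegral_const_mul _ (by fun_prop),
    lintegral_const_mul _ hm, lintegral_chainWeight hp hw]
  ring

lemma chainTail_succ {p w : ℝ → ℝ≥0∞} (hp : Measurable p) (hw : Measurable w) (z a : ℝ)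
    (n : ℕ) (i : Fin n) (x : ℝ) : chainTail p w z a (n + 1) i.succ x
      = ∫⁻ y, p (y - x) * (w y * chainTail p w z a n i y) := by
  have h1 := measurable_indicator_Ioi a
  have h2 := measurable_chainWeight_right hp hw z (n + 1) x
  unfold chainTail
  have h3 : Measurable fun q : Fin (n + 1) → ℝ =>
      (Set.Ioi a).indicator (1 : ℝ → ℝ≥0∞) (q i.succ) * chainWeight p w z (n + 1) x q :=
    (h1.comp (measurable_pi_apply i.succ)).mul h2
  rw [lintegral_fin_succ h3]
  simp only [chainWeight, Fin.cons_zero, Fin.cons_succ]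
  refine lintegral_congr fun y => ?_
  have hm := measurable_chainWeight_right hp hw z n y
  have hm' : Measurable fun q : Fin n → ℝ => (Set.Ioi a).indicator (1 : ℝ → ℝ≥0∞) (q i) :=
    h1.comp (measurable_pi_apply i)
  have h4 : Measurable fun q : Fin n → ℝ =>
      (Set.Ioi a).indicator (1 : ℝ → ℝ≥0∞) (q i) * chainWeight p w z n y q := hm'.mul hm
  rw [← lintegral_const_mul _ h4, ← lintegral_const_mul _ (by fun_prop)]
  refine lintegral_congr fun q => ?_
  ring

/-- A reference density `g` that dominates, in the likelihood ratio order, its images under the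
forward and backward kernels weighted by `v`. -/
structure DominatingDensity (p v g : ℝ → ℝ≥0∞) : Prop where
  measurable_kernel : Measurable p
  measurable_weight : Measurable v
  measurable_density : Measurable g
  totallyPositive : ∀ x y s t, x ≤ y → s ≤ t → p (y - s) * p (x - t) ≤ p (x - s) * p (y - t)
  forward : LRLe (fun x => v x * convOp p g x) g
  backward : LRLe (fun x => v x * convOp (fun s => p (-s)) g x) g
  forward_pos : ∀ x y, x ≤ y → g x ≠ 0 → v y * convOp p g y ≠ 0 ∧ v y * convOp p g y ≠ ∞
  backward_pos : ∀ x y, x ≤ y → g x ≠ 0 →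
    v y * convOp (fun s => p (-s)) g y ≠ 0 ∧ v y * convOp (fun s => p (-s)) g y ≠ ∞
  weight_anti : ∀ x y, x ≤ y → g x ≠ 0 → v y ≤ v x

namespace DominatingDensity

variable {p v g : ℝ → ℝ≥0∞}

lemma reflect (h : DominatingDensity p v g) : DominatingDensity (fun s => p (-s)) v g where
  measurable_kernel := h.measurable_kernel.comp measurable_neg
  measurable_weight := h.measurable_weight
  measurable_density := h.measurable_density
  totallyPositive x y s t hxy hst := by
    have := h.totallyPositive s t x y hst hxy
    simp only [neg_sub]
    calc _ = p (t - x) * p (s - y) := mul_comm _ _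
      _ ≤ _ := this
  forward := h.backward
  backward := by simpa only [neg_neg] using h.forward
  forward_pos := h.backward_pos
  backward_pos := by simpa only [neg_neg] using h.forward_pos
  weight_anti := h.weight_anti

lemma weight_mul (h : DominatingDensity p v g) {f : ℝ → ℝ≥0∞} (hf : LRLe f g) :
    LRLe (fun x => v x * f x) g := by
  intro x y hxy
  by_cases hg : g x = 0
  · simp [hg]
  calc v y * f y * g x = v y * (f y * g x) := by ring
    _ ≤ v x * (f x * g y) := mul_le_mul' (h.weight_anti x y hxy hg) (hf x y hxy)
    _ = _ := by ring

lemma weight_mul_of_le (h : DominatingDensity p v g) {f : ℝ → ℝ≥0∞}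
    (hf : LRLe f (convOp p g)) : LRLe (fun x => v x * f x) g := by
  have h1 : LRLe (fun x => v x * f x) (fun x => v x * convOp p g x) := by
    refine LRLe.mul (F := v) (G := v) (fun x y _ => by rw [mul_comm]) hf
  refine h1.trans_of_pos h.forward fun x y hxy hg => ?_
  have hx := h.forward_pos x x le_rfl hg
  have hy := h.forward_pos x y hxy hg
  exact ⟨hx.1, hy.1, hx.2, hy.2⟩

lemma weight_mul_convOp (h : DominatingDensity p v g) {f : ℝ → ℝ≥0∞} (hfm : Measurable f)
    (hf : LRLe f g) : LRLe (fun x => v x * convOp p f x) g :=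
  h.weight_mul_of_le
    (hf.conv h.measurable_kernel hfm h.measurable_density h.totallyPositive)

/-- A single transition from a point below the support of `g` is dominated by `g`. -/
lemma weight_mul_kernel (h : DominatingDensity p v g) {u : ℝ} (hu : ∀ x < u, g x = 0) :
    LRLe (fun x => v x * p (x - u)) g := by
  refine h.weight_mul_of_le fun x y hxy => ?_
  have hp := h.measurable_kernel
  have hg := h.measurable_density
  unfold convOp
  rw [← lintegral_const_mul _ (by fun_prop), ← lintegral_const_mul _ (by fun_prop)]
  refine lintegral_mono fun s => ?_
  rcases lt_or_ge s u with hs | hs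
  · simp [hu s hs]
  calc p (y - u) * (p (x - s) * g s) = (p (y - u) * p (x - s)) * g s := by ring
    _ ≤ (p (x - u) * p (y - s)) * g s := mul_le_mul_left (h.totallyPositive x y u s hxy hs) _
    _ = _ := by ring

lemma weight_mul_chainMass (h : DominatingDensity p v g) {z : ℝ} (hz : ∀ x < z, g x = 0) (n : ℕ) :
    LRLe (fun x => v x * chainMass p (fun x => v x * v x) z n x) g := by
  have hp := h.measurable_kernel
  have hv := h.measurable_weight
  induction n with
  | zero => simpa [chainMass] using h.reflect.weight_mul_kernel hz
  | succ n ih =>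
    have hw : Measurable fun x => v x * v x := hv.mul hv
    have hm := measurable_chainMass hp hw z n
    have := h.reflect.weight_mul_convOp (hv.mul (hv.mul hm)) (h.weight_mul ih)
    simpa [chainMass, convOp, mul_assoc] using this

lemma lintegral_chainTail_le (h : DominatingDensity p v g) {z a : ℝ} (hz : ∀ x < z, g x = 0)
    {b : ℝ≥0∞}
    (hb : ∫⁻ x in Set.Ioi a, g x * g x ≤ b * ∫⁻ x in Set.Iic a, g x * g x)
    (h0 : ∫⁻ x in Set.Iic a, g x * g x ≠ 0) (htop : ∫⁻ x in Set.Iic a, g x * g x ≠ ∞)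
    (n : ℕ) {f : ℝ → ℝ≥0∞} (hfm : Measurable f) (hf : LRLe f g) :
    (∫⁻ x, v x * f x * ((Set.Ioi a).indicator 1 x * chainMass p (fun x => v x * v x) z n x)
      ≤ b * ∫⁻ x, v x * f x * chainMass p (fun x => v x * v x) z n x) ∧
    ∀ i : Fin n, ∫⁻ x, v x * f x * chainTail p (fun x => v x * v x) z a n i x
      ≤ b * ∫⁻ x, v x * f x * chainMass p (fun x => v x * v x) z n x := by
  have hp := h.measurable_kernel
  have hv := h.measurable_weight
  have hg := h.measurable_density
  have hw : Measurable fun x => v x * v x := hv.mul hv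
  have base : ∀ (n : ℕ) {f : ℝ → ℝ≥0∞}, Measurable f → LRLe f g →
      ∫⁻ x, v x * f x * ((Set.Ioi a).indicator 1 x * chainMass p (fun x => v x * v x) z n x)
      ≤ b * ∫⁻ x, v x * f x * chainMass p (fun x => v x * v x) z n x := by
    intro n f hfm hf
    have hm := measurable_chainMass hp hw z n
    have := (hf.mul (h.weight_mul_chainMass hz n)).setLIntegral_le (by fun_prop) (by fun_prop)
      a hb h0 htop
    convert this using 1
    · rw [← lintegral_indicator measurableSet_Ioi]
      refine lintegral_congr fun x => ?_
      by_cases hx : x ∈ Set.Ioi a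
      · simp only [Set.indicator_of_mem hx, Pi.one_apply]; ring
      · simp [Set.indicator_of_notMem hx]
    · congr 1
      refine lintegral_congr fun x => ?_
      ring
  have swap : ∀ {f k : ℝ → ℝ≥0∞}, Measurable f → Measurable k →
      ∫⁻ x, v x * f x * ∫⁻ y, p (y - x) * (v y * v y * k y)
        = ∫⁻ y, v y * (v y * convOp p (fun x => v x * f x) y) * k y := by
    intro f k hf hk
    have e1 : ∀ x, v x * f x * ∫⁻ y, p (y - x) * (v y * v y * k y)
        = ∫⁻ y, v x * f x * (p (y - x) * (v y * v y * k y)) := fun x =>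
      (lintegral_const_mul _ (by fun_prop)).symm
    simp_rw [e1]
    rw [lintegral_lintegral_swap (by fun_prop)]
    refine lintegral_congr fun y => ?_
    unfold convOp
    calc _ = ∫⁻ x, (v y * v y * k y) * (p (y - x) * (v x * f x)) :=
          lintegral_congr fun x => by ring
      _ = (v y * v y * k y) * ∫⁻ x, p (y - x) * (v x * f x) := by
          rw [lintegral_const_mul _ (by fun_prop)]
      _ = _ := by ring
  refine ⟨base n hfm hf, ?_⟩
  induction n generalizing f with
  | zero => exact fun i => i.elim0
  | succ n ih =>
    have hm := measurable_chainMass hp hw z n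
    have hi := measurable_indicator_Ioi a
    have hTm : Measurable fun y => v y * convOp p (fun x => v x * f x) y :=
      hv.mul (measurable_convOp hp (hv.mul hfm))
    have hT : LRLe (fun y => v y * convOp p (fun x => v x * f x) y) g :=
      h.weight_mul_convOp (hv.mul hfm) (h.weight_mul hf)
    intro i
    rw [show chainMass p (fun x => v x * v x) z (n + 1) = fun x =>
      ∫⁻ y, p (y - x) * (v y * v y * chainMass p (fun x => v x * v x) z n y) from rfl,
      swap hfm hm]
    refine Fin.cases ?_ (fun j => ?_) i
    · simp_rw [chainTail_zero hp hw]
      rw [swap (k := fun y => (Set.Ioi a).indicator 1 y *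
        chainMass p (fun x => v x * v x) z n y) hfm (hi.mul hm)]
      exact base n hTm hT
    · simp_rw [chainTail_succ hp hw]
      rw [swap hfm (measurable_chainTail hp hw z a n j)]
      exact ih hTm hT j

lemma chainTail_le (h : DominatingDensity p v g) {u z a : ℝ} (hu : ∀ x < u, g x = 0)
    (hz : ∀ x < z, g x = 0) {b : ℝ≥0∞}
    (hb : ∫⁻ x in Set.Ioi a, g x * g x ≤ b * ∫⁻ x in Set.Iic a, g x * g x)
    (h0 : ∫⁻ x in Set.Iic a, g x * g x ≠ 0) (htop : ∫⁻ x in Set.Iic a, g x * g x ≠ ∞)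
    (n : ℕ) (i : Fin n) :
    chainTail p (fun x => v x * v x) z a n i u ≤ b * chainMass p (fun x => v x * v x) z n u := by
  have hp := h.measurable_kernel
  have hv := h.measurable_weight
  have hw : Measurable fun x => v x * v x := hv.mul hv
  have hfm : Measurable fun x => v x * p (x - u) := by fun_prop
  cases n with
  | zero => exact i.elim0
  | succ n =>
    obtain ⟨h1, h2⟩ := h.lintegral_chainTail_le hz hb h0 htop n hfm (h.weight_mul_kernel hu)
    have e : ∀ k : ℝ → ℝ≥0∞, ∫⁻ y, p (y - u) * (v y * v y * k y)
        = ∫⁻ x, v x * (v x * p (x - u)) * k x := fun k => lintegral_congr fun x => by ring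
    rw [show chainMass p (fun x => v x * v x) z (n + 1) u =
      ∫⁻ y, p (y - u) * (v y * v y * chainMass p (fun x => v x * v x) z n y) from rfl, e]
    refine Fin.cases ?_ (fun j => ?_) i
    · rw [chainTail_zero hp hw, e]
      exact h1
    · rw [chainTail_succ hp hw, e]
      exact h2 j

end DominatingDensity

/-- Transition kernel of the random walk with Hamiltonian `H`. -/
noncomputable def walkKernel (H : ℝ → ℝ) (s : ℝ) : ℝ≥0∞ := ENNReal.ofReal (Real.exp (-(H s)))

/-- Site weight of the area tilt above a floor at `0`. -/
noncomputable def siteWeight (c y : ℝ) : ℝ≥0∞ :=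
  if 0 ≤ y then ENNReal.ofReal (Real.exp (-(c * y))) else 0

lemma siteWeight_half_mul_self (c : ℝ) :
    siteWeight c = fun y => siteWeight (c / 2) y * siteWeight (c / 2) y := by
  funext y
  unfold siteWeight
  split_ifs
  · rw [← ENNReal.ofReal_mul (Real.exp_nonneg _), ← Real.exp_add]
    congr 2
    ring
  · simp

lemma pathOf_succ (u z : ℝ) (n : ℕ) (q : Fin (n + 1) → ℝ) (j : ℕ) :
    pathOf u z (n + 1) q (j + 1) = pathOf (q 0) z n (fun i => q i.succ) j := by
  unfold pathOf
  rcases j with _ | j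
  · simp
  · by_cases h : j + 1 ≤ n
    · simp [h]
    · simp [h]

lemma pathOf_zero (u z : ℝ) (n : ℕ) (q : Fin n → ℝ) : pathOf u z n q 0 = u := by
  simp [pathOf]

lemma bridgeDensity_succ (H : ℝ → ℝ) (u z : ℝ) (n : ℕ) (q : Fin (n + 1) → ℝ) :
    bridgeDensity H u z (n + 1) q
      = Real.exp (-(H (q 0 - u))) * bridgeDensity H (q 0) z n fun i => q i.succ := by
  unfold bridgeDensity
  rw [Finset.prod_range_succ']
  simp only [pathOf_succ, pathOf_zero]
  rw [mul_comm]

open scoped Classical in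
lemma tilted_density_eq (H : ℝ → ℝ) (z c : ℝ) (n : ℕ) (u : ℝ) (q : Fin n → ℝ) :
    ENNReal.ofReal (bridgeDensity H u z n q
      * Real.exp (-(c * ∑ j ∈ Finset.range (n + 1), (pathOf u z n q j - 0)))
      * if ∀ t, 1 ≤ t → t ≤ n → 0 ≤ pathOf u z n q t then 1 else 0)
      = ENNReal.ofReal (Real.exp (-(c * u)))
        * chainWeight (walkKernel H) (siteWeight c) z n u q := by
  induction n generalizing u with
  | zero =>
    have h : ∀ t, 1 ≤ t → t ≤ 0 → 0 ≤ pathOf u z 0 q t := fun t h1 h2 => by omega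
    rw [if_pos h, mul_one, mul_comm, ENNReal.ofReal_mul (Real.exp_nonneg _)]
    simp [bridgeDensity, chainWeight, pathOf, walkKernel]
  | succ n ih =>
    have hfloor : (∀ t, 1 ≤ t → t ≤ n + 1 → 0 ≤ pathOf u z (n + 1) q t) ↔
        0 ≤ q 0 ∧ ∀ t, 1 ≤ t → t ≤ n → 0 ≤ pathOf (q 0) z n (fun i => q i.succ) t := by
      constructor
      · intro h
        refine ⟨?_, fun t h1 h2 => ?_⟩
        · simpa [pathOf_succ, pathOf_zero] using h 1 le_rfl (by omega)
        · simpa [pathOf_succ] using h (t + 1) (by omega) (by omega)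
      · rintro ⟨h0, h⟩ t h1 h2
        obtain ⟨t, rfl⟩ : ∃ s, t = s + 1 := ⟨t - 1, by omega⟩
        rw [pathOf_succ]
        rcases Nat.eq_zero_or_pos t with rfl | ht
        · simpa [pathOf_zero] using h0
        · exact h t ht (by omega)
    rw [bridgeDensity_succ, Finset.sum_range_succ']
    simp only [pathOf_succ, pathOf_zero, hfloor]
    have ih' := ih (q 0) (fun i => q i.succ)
    simp only [chainWeight]
    by_cases h0 : 0 ≤ q 0
    · have hw : siteWeight c (q 0) = ENNReal.ofReal (Real.exp (-(c * q 0))) := by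
        simp [siteWeight, h0]
      rw [hw, ← ih', walkKernel, ← ENNReal.ofReal_mul (by positivity),
        ← ENNReal.ofReal_mul (by positivity)]
      congr 1
      simp only [h0, true_and, mul_add, neg_add, Real.exp_add, sub_zero]
      ring_nf
    · simp [h0, siteWeight]

lemma tiltedMeasure_univ {H : ℝ → ℝ} (hH : Measurable H) (u z c : ℝ) (n : ℕ) :
    tiltedMeasure H u z n c (fun _ => 0) Set.univ
      = ENNReal.ofReal (Real.exp (-(c * u)))
        * chainMass (walkKernel H) (siteWeight c) z n u := by
  have hp : Measurable (walkKernel H) := by unfold walkKernel; fun_prop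
  have hw : Measurable (siteWeight c) := by
    unfold siteWeight
    exact Measurable.ite measurableSet_Ici (by fun_prop) measurable_const
  rw [tiltedMeasure, withDensity_apply _ MeasurableSet.univ, Measure.restrict_univ,
    ← lintegral_chainWeight hp hw,
    ← lintegral_const_mul _ (measurable_chainWeight_right hp hw z n u)]
  exact lintegral_congr fun q => tilted_density_eq H z c n u q

lemma tiltedMeasure_tail {H : ℝ → ℝ} (hH : Measurable H) (u z c a : ℝ) (n : ℕ) (i : Fin n) :
    tiltedMeasure H u z n c (fun _ => 0) {q | a < q i}
      = ENNReal.ofReal (Real.exp (-(c * u)))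
        * chainTail (walkKernel H) (siteWeight c) z a n i u := by
  have hp : Measurable (walkKernel H) := by unfold walkKernel; fun_prop
  have hw : Measurable (siteWeight c) := by
    unfold siteWeight
    exact Measurable.ite measurableSet_Ici (by fun_prop) measurable_const
  have hE : MeasurableSet {q : Fin n → ℝ | a < q i} :=
    measurableSet_lt measurable_const (measurable_pi_apply i)
  have hm : Measurable fun q : Fin n → ℝ => (Set.Ioi a).indicator (1 : ℝ → ℝ≥0∞) (q i)
      * chainWeight (walkKernel H) (siteWeight c) z n u q :=
    ((measurable_indicator_Ioi a).comp (measurable_pi_apply i)).mul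
      (measurable_chainWeight_right hp hw z n u)
  rw [tiltedMeasure, withDensity_apply _ hE, chainTail, ← lintegral_const_mul _ hm,
    ← lintegral_indicator hE]
  refine lintegral_congr fun q => ?_
  simp only [Set.indicator_apply, Set.mem_ofPred_eq, Set.mem_Ioi]
  by_cases hq : a < q i
  · rw [if_pos hq, if_pos hq, Pi.one_apply, one_mul]
    exact tilted_density_eq H z c n u q
  · rw [if_neg hq, if_neg hq, zero_mul, mul_zero]

/-- The exponent of the reference density: it is cubic below the scale `L` and linear with slope
`μ` above. -/
noncomputable def psi (μ L x : ℝ) : ℝ := μ * (x - L * Real.arctan (x / L))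

/-- The derivative of `psi`. -/
noncomputable def psiDeriv (μ L x : ℝ) : ℝ := μ * x ^ 2 / (L ^ 2 + x ^ 2)

section psi

variable {μ L : ℝ}

lemma hasDerivAt_psi (hL : 0 < L) (x : ℝ) : HasDerivAt (psi μ L) (psiDeriv μ L x) x := by
  have h1 : HasDerivAt (fun x : ℝ => x / L) (1 / L) x := (hasDerivAt_id x).div_const L
  have h2 := ((hasDerivAt_id x).sub (h1.arctan.const_mul L)).const_mul μ
  refine h2.congr_deriv ?_
  unfold psiDeriv
  have : 0 < L ^ 2 + x ^ 2 := by positivity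
  field_simp
  ring

lemma psi_zero : psi μ L 0 = 0 := by simp [psi]

lemma psiDeriv_nonneg (hμ : 0 ≤ μ) (x : ℝ) : 0 ≤ psiDeriv μ L x := by
  unfold psiDeriv; positivity

lemma psiDeriv_le (hμ : 0 ≤ μ) (hL : 0 < L) (x : ℝ) : psiDeriv μ L x ≤ μ := by
  unfold psiDeriv
  rw [div_le_iff₀ (by positivity)]
  nlinarith [mul_nonneg hμ (sq_nonneg L)]

lemma psiDeriv_le_sq (hμ : 0 ≤ μ) (hL : 0 < L) (x : ℝ) :
    psiDeriv μ L x ≤ μ / L ^ 2 * x ^ 2 := by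
  unfold psiDeriv
  rw [div_mul_eq_mul_div]
  gcongr
  nlinarith [sq_nonneg x]

lemma psiDeriv_mono (hμ : 0 ≤ μ) (hL : 0 < L) {x y : ℝ} (hx : 0 ≤ x) (hxy : x ≤ y) :
    psiDeriv μ L x ≤ psiDeriv μ L y := by
  unfold psiDeriv
  rw [div_le_div_iff₀ (by positivity) (by positivity)]
  have h : x ^ 2 ≤ y ^ 2 := by gcongr
  nlinarith [mul_le_mul_of_nonneg_left h (mul_nonneg hμ (sq_nonneg L))]

lemma psi_monotone (hμ : 0 ≤ μ) (hL : 0 < L) : Monotone (psi μ L) :=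
  monotone_of_deriv_nonneg (fun x => (hasDerivAt_psi hL x).differentiableAt)
    fun x => (hasDerivAt_psi hL x).deriv ▸ psiDeriv_nonneg hμ x

lemma psi_nonneg (hμ : 0 ≤ μ) (hL : 0 < L) {x : ℝ} (hx : 0 ≤ x) : 0 ≤ psi μ L x :=
  psi_zero (μ := μ) (L := L) ▸ psi_monotone hμ hL hx

lemma psi_sub_le (hμ : 0 ≤ μ) (hL : 0 < L) {x y : ℝ} (hy : 0 ≤ y) (hyx : y ≤ x) :
    psi μ L x - psi μ L y ≤ psiDeriv μ L x * (x - y) := by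
  refine (convex_Icc y x).image_sub_le_mul_sub_of_deriv_le (f := psi μ L)
    (fun z _ => (hasDerivAt_psi hL z).continuousAt.continuousWithinAt)
    (fun z _ => (hasDerivAt_psi hL z).differentiableAt.differentiableWithinAt)
    (fun z hz => ?_) y (Set.left_mem_Icc.2 hyx) x (Set.right_mem_Icc.2 hyx) hyx
  rw [interior_Icc] at hz
  rw [(hasDerivAt_psi hL z).deriv]
  exact psiDeriv_mono hμ hL (hy.trans hz.1.le) hz.2.le

lemma le_psi_sub (hμ : 0 ≤ μ) (hL : 0 < L) {x y : ℝ} (hy : 0 ≤ y) (hyx : y ≤ x) :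
    psiDeriv μ L y * (x - y) ≤ psi μ L x - psi μ L y := by
  refine (convex_Icc y x).mul_sub_le_image_sub_of_le_deriv (f := psi μ L)
    (fun z _ => (hasDerivAt_psi hL z).continuousAt.continuousWithinAt)
    (fun z _ => (hasDerivAt_psi hL z).differentiableAt.differentiableWithinAt)
    (fun z hz => ?_) y (Set.left_mem_Icc.2 hyx) x (Set.right_mem_Icc.2 hyx) hyx
  rw [interior_Icc] at hz
  rw [(hasDerivAt_psi hL z).deriv]
  exact psiDeriv_mono hμ hL hy hz.1.le

lemma abs_psi_sub_le (hμ : 0 ≤ μ) (hL : 0 < L) {x y : ℝ} (hx : 0 ≤ x) (hy : 0 ≤ y) :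
    |psi μ L x - psi μ L y| ≤ μ * |x - y| := by
  wlog h : y ≤ x generalizing x y
  · rw [abs_sub_comm, abs_sub_comm x]
    exact this hy hx (le_of_not_ge h)
  rw [abs_of_nonneg (sub_nonneg.2 (psi_monotone hμ hL h)), abs_of_nonneg (sub_nonneg.2 h)]
  exact (psi_sub_le hμ hL hy h).trans
    (mul_le_mul_of_nonneg_right (psiDeriv_le hμ hL x) (sub_nonneg.2 h))

/-- The derivative of `psiDeriv`. -/
noncomputable def psiDeriv2 (μ L x : ℝ) : ℝ := 2 * μ * L ^ 2 * x / (L ^ 2 + x ^ 2) ^ 2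

lemma psiDeriv2_nonneg (hμ : 0 ≤ μ) {x : ℝ} (hx : 0 ≤ x) : 0 ≤ psiDeriv2 μ L x := by
  unfold psiDeriv2; positivity

lemma psiDeriv2_le (hμ : 0 ≤ μ) (hL : 0 < L) {x : ℝ} (hx : 0 ≤ x) :
    psiDeriv2 μ L x ≤ μ / L := by
  unfold psiDeriv2
  rw [div_le_div_iff₀ (by positivity) hL]
  have h1 : 2 * L * x ≤ L ^ 2 + x ^ 2 := by nlinarith [sq_nonneg (L - x)]
  have h2 : L ^ 2 ≤ L ^ 2 + x ^ 2 := by nlinarith [sq_nonneg x]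
  have h3 : L ^ 2 * (2 * L * x) ≤ (L ^ 2 + x ^ 2) * (L ^ 2 + x ^ 2) := by gcongr
  nlinarith [mul_le_mul_of_nonneg_left h3 hμ]

lemma psiDeriv_sub_le (hμ : 0 ≤ μ) (hL : 0 < L) (x y : ℝ) :
    psiDeriv μ L x - psiDeriv μ L y
      ≤ psiDeriv2 μ L x * (x - y) + 2 * (μ / L ^ 2) * (x - y) ^ 2 := by
  have hA : 0 < L ^ 2 + x ^ 2 := by positivity
  have hB : 0 < L ^ 2 + y ^ 2 := by positivity
  have e : psiDeriv μ L x - psiDeriv μ L y - psiDeriv2 μ L x * (x - y)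
      = μ * L ^ 2 * (x - y) ^ 2 * ((x ^ 2 + 2 * x * y - L ^ 2)
        / ((L ^ 2 + x ^ 2) ^ 2 * (L ^ 2 + y ^ 2))) := by
    unfold psiDeriv psiDeriv2
    field_simp
    ring
  have hle : (x ^ 2 + 2 * x * y - L ^ 2) / ((L ^ 2 + x ^ 2) ^ 2 * (L ^ 2 + y ^ 2))
      ≤ 2 / L ^ 4 := by
    rw [div_le_div_iff₀ (by positivity) (by positivity)]
    have h1 : 2 * x * y ≤ x ^ 2 + y ^ 2 := by nlinarith [sq_nonneg (x - y)]
    have h2 : L ^ 4 * (x ^ 2 + 2 * x * y - L ^ 2) ≤ L ^ 4 * (2 * x ^ 2 + y ^ 2) := by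
      gcongr
      nlinarith [sq_nonneg L]
    have h3 : 0 ≤ 2 * L ^ 6 + 2 * L ^ 4 * x ^ 2 + L ^ 4 * y ^ 2 + 4 * L ^ 2 * x ^ 2 * y ^ 2
      + 2 * x ^ 4 * L ^ 2 + 2 * x ^ 4 * y ^ 2 := by positivity
    nlinarith
  have h := mul_le_mul_of_nonneg_left hle
    (show 0 ≤ μ * L ^ 2 * (x - y) ^ 2 by positivity)
  have e2 : μ * L ^ 2 * (x - y) ^ 2 * (2 / L ^ 4) = 2 * (μ / L ^ 2) * (x - y) ^ 2 := by
    field_simp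
  linarith

set_option maxHeartbeats 1000000 in
/-- Pointwise bound for the logarithmic derivative comparison of the reference density with its
image under a random walk step of size `s` ending at `x`. -/
lemma step_bound (hμ : 0 ≤ μ) (hμ1 : μ ≤ 1) (hL : 0 < L) {c x s : ℝ} (hc : 0 ≤ c) (hx : 0 < x)
    (hs : s < x) :
    Real.exp (psi μ L x - psi μ L (x - s))
        * (s + x * (x - s) * (psiDeriv μ L x - psiDeriv μ L (x - s) - c))
      ≤ (1 + x ^ 2 * psiDeriv2 μ L x) * s
        + (max x 1) ^ 2 * (3 * (μ / L ^ 2) + μ ^ 2 / L)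
          * ((1 + |s|) ^ 4 * Real.exp (μ * |s|))
        - c * Real.exp (-1) * x ^ 2 * (Set.Icc (-1) 0).indicator 1 s := by
  set y := x - s with hy
  have hy0 : 0 < y := by linarith
  set X := max x 1 with hX
  have hxX : x ≤ X := le_max_left _ _
  have h1X : 1 ≤ X := le_max_right _ _
  set m' := psiDeriv2 μ L x
  have hm' : 0 ≤ m' := psiDeriv2_nonneg hμ hx.le
  have hm'2 : m' ≤ μ / L := psiDeriv2_le hμ hL hx.le
  set e := Real.exp (psi μ L x - psi μ L y)
  have he0 : 0 < e := Real.exp_pos _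
  have hΔ := abs_psi_sub_le hμ hL hx.le hy0.le
  rw [show x - y = s by rw [hy]; ring] at hΔ
  have he1 : e ≤ Real.exp (μ * |s|) := Real.exp_le_exp.2 ((le_abs_self _).trans hΔ)
  have he2 : Real.exp (-(μ * |s|)) ≤ e := Real.exp_le_exp.2 (neg_le_of_abs_le hΔ)
  set E := Real.exp (μ * |s|)
  have hE1 : 1 ≤ E := Real.one_le_exp (by positivity)
  set D := psiDeriv μ L (x + |s|)
  have hD0 : 0 ≤ D := psiDeriv_nonneg hμ _
  have hs0 := abs_nonneg s
  have hyX : y ≤ X * (1 + |s|) := by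
    have := neg_abs_le s
    nlinarith
  -- first order term
  have hA : s * (e - 1) ≤ s ^ 2 * D * E := by
    rcases le_or_gt 0 s with h | h
    · have h1 : psi μ L x - psi μ L y ≤ D * s := by
        have h2 := psi_sub_le hμ hL hy0.le (show y ≤ x by linarith)
        rw [show x - y = s by rw [hy]; ring] at h2
        have h3 : psiDeriv μ L x ≤ D := psiDeriv_mono hμ hL hx.le (by linarith)
        nlinarith
      have h4 : e - 1 ≤ (psi μ L x - psi μ L y) * e := by
        have h5 := Real.add_one_le_exp (-(psi μ L x - psi μ L y))
        have h6 : Real.exp (-(psi μ L x - psi μ L y)) * e = 1 := by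
          rw [← Real.exp_add]; simp
        nlinarith
      have h7 : (psi μ L x - psi μ L y) * e ≤ D * s * E := by
        have : 0 ≤ D * s := by positivity
        nlinarith
      nlinarith
    · have h1 : psi μ L y - psi μ L x ≤ D * (-s) := by
        have h2 := psi_sub_le hμ hL hx.le (show x ≤ y by linarith)
        rw [show y - x = -s by rw [hy]; ring,
          show psiDeriv μ L y = D by simp only [D, hy, abs_of_neg h, sub_eq_add_neg]] at h2
        exact h2
      have h5 : psi μ L x - psi μ L y + 1 ≤ e := Real.add_one_le_exp _
      have h6 : s * (e - 1) ≤ s ^ 2 * D := by nlinarith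
      have h7 : 0 ≤ s ^ 2 * D := by positivity
      nlinarith
  -- size of the slope
  have hD1 : (1 + x ^ 2 * m') * D ≤ X ^ 2 * (μ / L ^ 2 + μ ^ 2 / L) * (1 + |s|) ^ 2 := by
    have h1 : D ≤ μ / L ^ 2 * (X ^ 2 * (1 + |s|) ^ 2) := by
      refine (psiDeriv_le_sq hμ hL _).trans ?_
      rw [← mul_pow]
      gcongr
      nlinarith
    have h2 : x ^ 2 * m' * D ≤ X ^ 2 * (μ / L) * μ := by
      gcongr
      exact psiDeriv_le hμ hL _
    have h3 : X ^ 2 * (μ / L) * μ ≤ X ^ 2 * (μ / L) * μ * (1 + |s|) ^ 2 :=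
      le_mul_of_one_le_right (by positivity) (by nlinarith)
    have h4 : X ^ 2 * (μ / L) * μ = X ^ 2 * (μ ^ 2 / L) := by ring
    rw [h4] at h3 h2
    linarith
  have hs2 : s ^ 2 ≤ (1 + |s|) ^ 2 := by
    rw [← sq_abs s]
    gcongr
    linarith
  have hT1 : (1 + x ^ 2 * m') * (s * (e - 1))
      ≤ X ^ 2 * (μ / L ^ 2 + μ ^ 2 / L) * ((1 + |s|) ^ 4 * E) := by
    calc (1 + x ^ 2 * m') * (s * (e - 1)) ≤ (1 + x ^ 2 * m') * (s ^ 2 * D * E) := by gcongr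
      _ = ((1 + x ^ 2 * m') * D) * (s ^ 2 * E) := by ring
      _ ≤ (X ^ 2 * (μ / L ^ 2 + μ ^ 2 / L) * (1 + |s|) ^ 2) * ((1 + |s|) ^ 2 * E) := by gcongr
      _ = _ := by ring
  have hT2 : e * (x * y * (2 * (μ / L ^ 2) * s ^ 2))
      ≤ X ^ 2 * (2 * (μ / L ^ 2)) * ((1 + |s|) ^ 4 * E) := by
    calc e * (x * y * (2 * (μ / L ^ 2) * s ^ 2))
        ≤ E * (X * (X * (1 + |s|)) * (2 * (μ / L ^ 2) * (1 + |s|) ^ 2)) := by gcongr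
      _ = X ^ 2 * (2 * (μ / L ^ 2)) * ((1 + |s|) ^ 3 * E) := by ring
      _ ≤ _ := by
        gcongr
        · linarith
        · norm_num
  have hT3 : c * Real.exp (-1) * x ^ 2 * (Set.Icc (-1) 0).indicator 1 s ≤ c * (e * (x * y)) := by
    by_cases h : s ∈ Set.Icc (-1 : ℝ) 0
    · rw [Set.indicator_of_mem h, Pi.one_apply]
      have h1 : |s| ≤ 1 := abs_le.2 ⟨h.1, by linarith [h.2]⟩
      have h2 : Real.exp (-1) ≤ e := (Real.exp_le_exp.2 (by nlinarith)).trans he2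
      have h3 : x ^ 2 ≤ x * y := by nlinarith [h.2]
      calc c * Real.exp (-1) * x ^ 2 * 1 = c * (Real.exp (-1) * x ^ 2) := by ring
        _ ≤ _ := by gcongr
    · rw [Set.indicator_of_notMem h, mul_zero]
      positivity
  have hM := psiDeriv_sub_le hμ hL x y
  rw [show x - y = s by rw [hy]; ring] at hM
  have hM2 : e * (s + x * y * (psiDeriv μ L x - psiDeriv μ L y))
      ≤ e * ((1 + x ^ 2 * m') * s) + e * (x * y * (2 * (μ / L ^ 2) * s ^ 2)) := by
    rw [← mul_add]
    refine mul_le_mul_of_nonneg_left ?_ he0.le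
    have h1 := mul_le_mul_of_nonneg_left hM (show 0 ≤ x * y by positivity)
    have h3 : 0 ≤ x * m' * s ^ 2 := by positivity
    have h4 : x * y * (m' * s) = x ^ 2 * m' * s - x * m' * s ^ 2 := by
      rw [hy]
      ring
    rw [mul_add, h4] at h1
    linarith only [h1, h3]
  calc _ = e * (s + x * y * (psiDeriv μ L x - psiDeriv μ L y)) - c * (e * (x * y)) := by ring
    _ ≤ (e * ((1 + x ^ 2 * m') * s) + e * (x * y * (2 * (μ / L ^ 2) * s ^ 2)))
        - c * Real.exp (-1) * x ^ 2 * (Set.Icc (-1) 0).indicator 1 s := sub_le_sub hM2 hT3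
    _ = ((1 + x ^ 2 * m') * s + (1 + x ^ 2 * m') * (s * (e - 1))
        + e * (x * y * (2 * (μ / L ^ 2) * s ^ 2)))
        - c * Real.exp (-1) * x ^ 2 * (Set.Icc (-1) 0).indicator 1 s := by ring
    _ ≤ _ := by linarith

end psi

/-- The reference density: linear near zero, with cubic decay exponent up to the scale `L` and
exponential decay with rate `μ` beyond. -/
noncomputable def refDensity (μ L y : ℝ) : ℝ := max y 0 * Real.exp (-(psi μ L y))

/-- The derivative of `refDensity` away from zero. -/
noncomputable def refDensityDeriv (μ L y : ℝ) : ℝ :=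
  if 0 < y then (1 - y * psiDeriv μ L y) * Real.exp (-(psi μ L y)) else 0

section refDensity

variable {μ L : ℝ}

lemma refDensity_of_nonpos {y : ℝ} (hy : y ≤ 0) : refDensity μ L y = 0 := by
  simp [refDensity, max_eq_right hy]

lemma refDensity_of_nonneg {y : ℝ} (hy : 0 ≤ y) :
    refDensity μ L y = y * Real.exp (-(psi μ L y)) := by
  simp [refDensity, max_eq_left hy]

lemma refDensity_pos {y : ℝ} (hy : 0 < y) : 0 < refDensity μ L y := by
  rw [refDensity_of_nonneg hy.le]; positivity

lemma refDensity_nonneg (y : ℝ) : 0 ≤ refDensity μ L y := by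
  unfold refDensity; positivity

lemma refDensity_le_abs (hμ : 0 ≤ μ) (hL : 0 < L) (y : ℝ) : refDensity μ L y ≤ |y| := by
  rcases le_total y 0 with h | h
  · rw [refDensity_of_nonpos h]; positivity
  · rw [refDensity_of_nonneg h, abs_of_nonneg h]
    refine mul_le_of_le_one_right h (Real.exp_le_one_iff.2 ?_)
    linarith [psi_nonneg hμ hL h]

lemma continuous_psi (hL : 0 < L) : Continuous (psi μ L) :=
  continuous_iff_continuousAt.2 fun x => (hasDerivAt_psi hL x).continuousAt

lemma continuous_refDensity (hL : 0 < L) : Continuous (refDensity μ L) :=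
  (continuous_id.max continuous_const).mul (Real.continuous_exp.comp (continuous_psi hL).neg)

lemma hasDerivAt_mul_exp_psi (hL : 0 < L) (y : ℝ) :
    HasDerivAt (fun w => w * Real.exp (-(psi μ L w)))
      ((1 - y * psiDeriv μ L y) * Real.exp (-(psi μ L y))) y := by
  refine ((hasDerivAt_id y).mul (hasDerivAt_psi (μ := μ) hL y).neg.exp).congr_deriv ?_
  simp only [id, Pi.neg_apply]
  ring

lemma hasDerivAt_refDensity (hL : 0 < L) {y : ℝ} (hy : y ≠ 0) :
    HasDerivAt (refDensity μ L) (refDensityDeriv μ L y) y := by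
  unfold refDensityDeriv
  split_ifs with h
  · refine (hasDerivAt_mul_exp_psi hL y).congr_of_eventuallyEq ?_
    filter_upwards [lt_mem_nhds h] with w hw using refDensity_of_nonneg hw.le
  · refine (hasDerivAt_const y (0 : ℝ)).congr_of_eventuallyEq ?_
    filter_upwards [gt_mem_nhds (lt_of_le_of_ne (not_lt.1 h) hy)] with w hw
      using refDensity_of_nonpos (le_of_lt hw)

lemma measurable_refDensityDeriv (hL : 0 < L) : Measurable (refDensityDeriv μ L) := by
  unfold refDensityDeriv
  have h := (continuous_psi (μ := μ) hL).measurable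
  refine Measurable.ite measurableSet_Ioi ?_ measurable_const
  unfold psiDeriv
  fun_prop

lemma abs_mul_exp_psi_deriv_le (hμ : 0 ≤ μ) (hL : 0 < L) {y r : ℝ} (hy : 0 ≤ y) (hr : y ≤ r) :
    |(1 - y * psiDeriv μ L y) * Real.exp (-(psi μ L y))| ≤ 1 + μ * r := by
  have h1 : Real.exp (-(psi μ L y)) ≤ 1 :=
    Real.exp_le_one_iff.2 (by linarith [psi_nonneg (μ := μ) hμ hL hy])
  have h2 : y * psiDeriv μ L y ≤ r * μ :=
    mul_le_mul hr (psiDeriv_le hμ hL y) (psiDeriv_nonneg hμ y) (hy.trans hr)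
  have h3 : 0 ≤ y * psiDeriv μ L y := mul_nonneg hy (psiDeriv_nonneg hμ y)
  have h4 : |1 - y * psiDeriv μ L y| ≤ 1 + μ * r := abs_le.2 ⟨by linarith, by linarith⟩
  rw [abs_mul, abs_of_pos (Real.exp_pos _)]
  exact (mul_le_of_le_one_right (abs_nonneg _) h1).trans h4

lemma abs_refDensity_sub_le (hμ : 0 ≤ μ) (hL : 0 < L) {y z r : ℝ} (hr : 0 ≤ r) (hy : y ≤ r)
    (hz : z ≤ r) : |refDensity μ L y - refDensity μ L z| ≤ (1 + μ * r) * |y - z| := by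
  have key : ∀ w : ℝ, refDensity μ L w = max w 0 * Real.exp (-(psi μ L (max w 0))) := by
    intro w
    rcases le_total w 0 with h | h
    · rw [refDensity_of_nonpos h, max_eq_right h, zero_mul]
    · rw [refDensity_of_nonneg h, max_eq_left h]
  rw [key y, key z]
  have h := (convex_Icc (0 : ℝ) r).norm_image_sub_le_of_norm_hasDerivWithin_le
    (f := fun w => w * Real.exp (-(psi μ L w)))
    (f' := fun w => (1 - w * psiDeriv μ L w) * Real.exp (-(psi μ L w))) (C := 1 + μ * r)
    (fun w _ => (hasDerivAt_mul_exp_psi hL w).hasDerivWithinAt)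
    (fun w hw => abs_mul_exp_psi_deriv_le hμ hL hw.1 hw.2)
    (⟨le_max_right _ _, max_le hz hr⟩ : max z 0 ∈ Set.Icc 0 r)
    (⟨le_max_right _ _, max_le hy hr⟩ : max y 0 ∈ Set.Icc 0 r)
  simp only [Real.norm_eq_abs] at h
  exact h.trans (mul_le_mul_of_nonneg_left (abs_max_sub_max_le_abs y z 0) (by positivity))

end refDensity

/-- A positive continuous centered kernel with exponential moments of order `τ`. -/
structure CenteredKernel (p : ℝ → ℝ) (τ : ℝ) : Prop where
  continuous : Continuous p
  pos : ∀ s, 0 < p s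
  order_pos : 0 < τ
  integrable : Integrable fun s => p s * ((1 + |s|) ^ 4 * Real.exp (τ * |s|))
  mean_zero : ∫ s, p s * s = 0

/-- The image of the reference density under the kernel. -/
noncomputable def refConv (p : ℝ → ℝ) (μ L x : ℝ) : ℝ := ∫ s, p s * refDensity μ L (x - s)

/-- The derivative of `refConv`. -/
noncomputable def refConvDeriv (p : ℝ → ℝ) (μ L x : ℝ) : ℝ :=
  ∫ s, p s * refDensityDeriv μ L (x - s)

namespace CenteredKernel

variable {p : ℝ → ℝ} {τ μ L : ℝ}

lemma integrable_affine (h : CenteredKernel p τ) (a b : ℝ) :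
    Integrable fun s => p s * (a + b * |s|) := by
  refine (h.integrable.const_mul (|a| + |b|)).mono'
    ((h.continuous.mul (by fun_prop)).aestronglyMeasurable) (Filter.Eventually.of_forall fun s => ?_)
  have h0 := abs_nonneg s
  have h1 : 1 ≤ Real.exp (τ * |s|) := Real.one_le_exp (mul_nonneg h.order_pos.le h0)
  have h2 : 1 + |s| ≤ (1 + |s|) ^ 4 := le_self_pow₀ (by linarith) (by norm_num)
  have h3 : 1 + |s| ≤ (1 + |s|) ^ 4 * Real.exp (τ * |s|) :=
    h2.trans (le_mul_of_one_le_right (by positivity) h1)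
  have h4 : |a + b * abs s| ≤ (|a| + |b|) * (1 + |s|) := by
    refine (abs_add_le _ _).trans ?_
    rw [abs_mul, abs_abs]
    linarith [mul_nonneg (abs_nonneg a) h0, abs_nonneg b]
  rw [Real.norm_eq_abs, abs_mul, abs_of_pos (h.pos s)]
  calc p s * |a + b * abs s| ≤ p s * ((|a| + |b|) * (1 + |s|)) := by gcongr; exact (h.pos s).le
    _ ≤ p s * ((|a| + |b|) * ((1 + |s|) ^ 4 * Real.exp (τ * |s|))) := by
      gcongr; exact (h.pos s).le
    _ = _ := by ring

lemma integrable_mul_of_le (h : CenteredKernel p τ) {f : ℝ → ℝ} (hf : Measurable f) (a b : ℝ)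
    (hb : ∀ s, |f s| ≤ a + b * |s|) : Integrable fun s => p s * f s := by
  refine (h.integrable_affine a b).mono' (h.continuous.measurable.mul hf).aestronglyMeasurable
    (Filter.Eventually.of_forall fun s => ?_)
  rw [Real.norm_eq_abs, abs_mul, abs_of_pos (h.pos s)]
  exact mul_le_mul_of_nonneg_left (hb s) (h.pos s).le

lemma integrable_mul_id (h : CenteredKernel p τ) : Integrable fun s => p s * s :=
  h.integrable_mul_of_le measurable_id 0 1 fun s => by simp

lemma integrable_mul_refDensity (h : CenteredKernel p τ) (hμ : 0 ≤ μ) (hL : 0 < L) (x : ℝ) :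
    Integrable fun s => p s * refDensity μ L (x - s) := by
  refine h.integrable_mul_of_le
    ((continuous_refDensity hL).measurable.comp (measurable_const.sub measurable_id)) |x| 1
    fun s => ?_
  rw [abs_of_nonneg (refDensity_nonneg _), one_mul]
  exact (refDensity_le_abs hμ hL _).trans (abs_sub _ _)

lemma integrable_mul_refDensityDeriv (h : CenteredKernel p τ) (hμ : 0 ≤ μ) (hL : 0 < L) (x : ℝ) :
    Integrable fun s => p s * refDensityDeriv μ L (x - s) := by
  refine h.integrable_mul_of_le
    ((measurable_refDensityDeriv hL).comp (measurable_const.sub measurable_id)) (1 + μ * |x|) μ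
    fun s => ?_
  unfold refDensityDeriv
  have h1 : x - s ≤ |x| + |s| := (le_abs_self _).trans (abs_sub _ _)
  split_ifs with h0
  · refine (abs_mul_exp_psi_deriv_le hμ hL h0.le h1).trans (le_of_eq (by ring))
  · rw [abs_zero]; positivity

lemma hasDerivAt_refConv (h : CenteredKernel p τ) (hμ : 0 ≤ μ) (hL : 0 < L) (x : ℝ) :
    HasDerivAt (refConv p μ L) (refConvDeriv p μ L x) x := by
  have hmeas : ∀ y, AEStronglyMeasurable (fun s => p s * refDensity μ L (y - s)) volume :=
    fun y => (h.integrable_mul_refDensity hμ hL y).aestronglyMeasurable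
  refine (hasDerivAt_integral_of_dominated_loc_of_lip
    (F := fun y s => p s * refDensity μ L (y - s))
    (F' := fun s => p s * refDensityDeriv μ L (x - s))
    (bound := fun s => p s * ((1 + μ * (|x| + 1)) + μ * |s|))
    (Metric.ball_mem_nhds x one_pos) (Filter.Eventually.of_forall hmeas)
    (h.integrable_mul_refDensity hμ hL x)
    (h.integrable_mul_refDensityDeriv hμ hL x).aestronglyMeasurable
    (Filter.Eventually.of_forall fun s => ?_) (h.integrable_affine _ _) ?_).2
  · have hb : 0 ≤ p s * ((1 + μ * (|x| + 1)) + μ * |s|) :=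
      mul_nonneg (h.pos s).le (by positivity)
    refine LipschitzOnWith.of_dist_le_mul fun y hy z hz => ?_
    rw [Real.coe_nnabs, abs_of_nonneg hb, Real.dist_eq, Real.dist_eq, ← mul_sub, abs_mul,
      abs_of_pos (h.pos s), mul_assoc]
    refine mul_le_mul_of_nonneg_left ?_ (h.pos s).le
    have hball : ∀ w ∈ Metric.ball x 1, w - s ≤ |x| + 1 + |s| := fun w hw => by
      rw [Metric.mem_ball, Real.dist_eq] at hw
      linarith [le_abs_self (w - x), le_abs_self x, neg_abs_le s]
    refine (abs_refDensity_sub_le hμ hL (by positivity) (hball y hy) (hball z hz)).trans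
      (le_of_eq ?_)
    rw [show y - s - (z - s) = y - z by ring]
    ring
  · have hne : ∀ᵐ s : ℝ, s ≠ x := by
      simp [ae_iff, measure_singleton]
    filter_upwards [hne] with s hs
    have h1 := (hasDerivAt_refDensity (μ := μ) hL (sub_ne_zero.2 hs.symm)).comp x
      ((hasDerivAt_id x).sub_const s)
    refine (h1.const_mul (p s)).congr_deriv ?_
    ring

end CenteredKernel

/-- The exponential moment controlling the error terms. -/
noncomputable def errorMoment (p : ℝ → ℝ) (τ : ℝ) : ℝ :=
  ∫ s, p s * ((1 + |s|) ^ 4 * Real.exp (τ * |s|))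

/-- The mass of a kernel on `[-1, 0]`. -/
noncomputable def leftMass (p : ℝ → ℝ) : ℝ :=
  ∫ s, p s * (Set.Icc (-1) 0).indicator (fun _ => (1 : ℝ)) s

/-- The first moment of a kernel beyond `1`. -/
noncomputable def upperMoment (p : ℝ → ℝ) : ℝ := ∫ s, p s * (Set.Ici 1).indicator id s

/-- The relative size of the errors made when comparing the reference density with its image. -/
noncomputable def errorSize (μ L : ℝ) : ℝ := 3 * (μ / L ^ 2) + μ ^ 2 / L

namespace CenteredKernel

variable {p : ℝ → ℝ} {τ μ L c : ℝ}

lemma integrable_mul_indicator_left (h : CenteredKernel p τ) :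
    Integrable fun s => p s * (Set.Icc (-1) 0).indicator (fun _ => (1 : ℝ)) s :=
  h.integrable_mul_of_le (measurable_const.indicator measurableSet_Icc) 1 0 fun s => by
    by_cases hs : s ∈ Set.Icc (-1 : ℝ) 0 <;> simp [hs]

lemma integrable_mul_indicator_upper (h : CenteredKernel p τ) :
    Integrable fun s => p s * (Set.Ici 1).indicator id s :=
  h.integrable_mul_of_le (measurable_id.indicator measurableSet_Ici) 0 1 fun s => by
    by_cases hs : s ∈ Set.Ici (1 : ℝ)
    · simp only [Set.indicator_of_mem hs, id, zero_add, one_mul, le_refl]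
    · simp only [Set.indicator_of_notMem hs, abs_zero, zero_add, one_mul, abs_nonneg]

lemma leftMass_pos (h : CenteredKernel p τ) : 0 < leftMass p := by
  unfold leftMass
  refine (integral_pos_iff_support_of_nonneg (fun s => mul_nonneg (h.pos s).le
    (Set.indicator_nonneg (fun _ _ => zero_le_one) s)) h.integrable_mul_indicator_left).2 ?_
  refine lt_of_lt_of_le ?_ (measure_mono (s := Set.Icc (-1 : ℝ) 0) fun s hs => ?_)
  · simp
  · simp [Set.indicator_of_mem hs, (h.pos s).ne']

lemma upperMoment_pos (h : CenteredKernel p τ) : 0 < upperMoment p := by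
  unfold upperMoment
  refine (integral_pos_iff_support_of_nonneg (fun s => mul_nonneg (h.pos s).le
    (Set.indicator_nonneg (fun a ha => zero_le_one.trans ha) s))
    h.integrable_mul_indicator_upper).2 ?_
  have hsub : Set.Ici 1 ⊆ Function.support fun s => p s * (Set.Ici 1).indicator id s := by
    intro s hs
    rw [Function.mem_support, Set.indicator_of_mem hs]
    exact mul_ne_zero (h.pos s).ne' (zero_lt_one.trans_le hs).ne'
  exact lt_of_lt_of_le (by simp) (measure_mono hsub)

lemma errorMoment_pos (h : CenteredKernel p τ) : 0 < errorMoment p τ := by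
  unfold errorMoment
  refine (integral_pos_iff_support_of_nonneg (fun s => mul_nonneg (h.pos s).le
    (by positivity)) h.integrable).2 ?_
  have : (Function.support fun s => p s * ((1 + |s|) ^ 4 * Real.exp (τ * |s|))) = Set.univ :=
    Set.eq_univ_of_forall fun s => mul_ne_zero (h.pos s).ne' (by positivity)
  simp [this]

lemma wronskian_integrand {x : ℝ} (hx : 0 < x) (s : ℝ) :
    refDensityDeriv μ L (x - s) * refDensity μ L x
        - refDensity μ L (x - s) * (refDensityDeriv μ L x + c * refDensity μ L x)
      = if s < x then Real.exp (-(2 * psi μ L x)) *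
          (Real.exp (psi μ L x - psi μ L (x - s))
            * (s + x * (x - s) * (psiDeriv μ L x - psiDeriv μ L (x - s) - c))) else 0 := by
  split_ifs with hs
  · have hy : 0 < x - s := sub_pos.2 hs
    have e : Real.exp (-(2 * psi μ L x)) * Real.exp (psi μ L x - psi μ L (x - s))
        = Real.exp (-psi μ L x) * Real.exp (-psi μ L (x - s)) := by
      rw [← Real.exp_add, ← Real.exp_add]
      ring_nf
    rw [← mul_assoc, e, refDensity_of_nonneg hx.le, refDensity_of_nonneg hy.le, refDensityDeriv,
      if_pos hy, refDensityDeriv, if_pos hx]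
    ring
  · have hy : x - s ≤ 0 := sub_nonpos.2 (not_lt.1 hs)
    rw [refDensity_of_nonpos hy, refDensityDeriv, if_neg (not_lt.2 hy)]
    ring

lemma wronskian_bound (h : CenteredKernel p τ) (hμ : 0 ≤ μ) (hμ1 : μ ≤ 1) (hμτ : μ ≤ τ)
    (hL : 0 < L) (hc : 0 ≤ c) {x : ℝ} (hx : 0 < x) {b₁ b₂ : ℝ}
    (hb₁ : b₁ = 0 ∨ b₁ = 1 ∧ x ≤ 1) (hb₂ : b₂ = 0 ∨ b₂ = c * Real.exp (-1) * x ^ 2) (s : ℝ) :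
    p s * (refDensityDeriv μ L (x - s) * refDensity μ L x
        - refDensity μ L (x - s) * (refDensityDeriv μ L x + c * refDensity μ L x))
      ≤ Real.exp (-(2 * psi μ L x)) * ((1 + x ^ 2 * psiDeriv2 μ L x) * (p s * s)
        + (max x 1) ^ 2 * errorSize μ L * (p s * ((1 + |s|) ^ 4 * Real.exp (τ * |s|)))
        - b₁ * (p s * (Set.Ici 1).indicator id s)
        - b₂ * (p s * (Set.Icc (-1) 0).indicator (fun _ => (1 : ℝ)) s)) := by
  have hE : 0 ≤ errorSize μ L := by unfold errorSize; positivity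
  have hw : (max x 1) ^ 2 * errorSize μ L * ((1 + |s|) ^ 4 * Real.exp (μ * |s|))
      ≤ (max x 1) ^ 2 * errorSize μ L * ((1 + |s|) ^ 4 * Real.exp (τ * |s|)) := by gcongr
  have h2 := psiDeriv2_nonneg (L := L) hμ hx.le
  suffices hB : (if s < x then Real.exp (psi μ L x - psi μ L (x - s))
      * (s + x * (x - s) * (psiDeriv μ L x - psiDeriv μ L (x - s) - c)) else 0)
      ≤ (1 + x ^ 2 * psiDeriv2 μ L x) * s
        + (max x 1) ^ 2 * errorSize μ L * ((1 + |s|) ^ 4 * Real.exp (τ * |s|))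
        - b₁ * (Set.Ici 1).indicator id s
        - b₂ * (Set.Icc (-1) 0).indicator (fun _ => (1 : ℝ)) s by
    rw [wronskian_integrand hx]
    have := mul_le_mul_of_nonneg_left hB
      (mul_nonneg (h.pos s).le (Real.exp_pos (-(2 * psi μ L x))).le)
    refine le_trans (le_of_eq ?_) (this.trans (le_of_eq ?_))
    · split_ifs <;> ring
    · ring
  have hi : 0 ≤ (Set.Icc (-1 : ℝ) 0).indicator (fun _ => (1 : ℝ)) s :=
    Set.indicator_nonneg (fun _ _ => zero_le_one) s
  split_ifs with hs
  · have hstep := step_bound hμ hμ1 hL hc hx hs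
    have h1 : b₁ * (Set.Ici 1).indicator id s = 0 := by
      rcases hb₁ with rfl | ⟨-, hx1⟩
      · simp
      · rw [Set.indicator_of_notMem (by simpa using hs.trans_le hx1), mul_zero]
    have h3 : b₂ * (Set.Icc (-1) 0).indicator (fun _ => (1 : ℝ)) s
        ≤ c * Real.exp (-1) * x ^ 2 * (Set.Icc (-1) 0).indicator 1 s := by
      rcases hb₂ with rfl | rfl
      · rw [zero_mul]
        exact mul_nonneg (by positivity) hi
      · exact le_rfl
    unfold errorSize at hw ⊢
    linarith
  · have hs' : x ≤ s := not_lt.1 hs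
    have h1 : b₁ * (Set.Ici 1).indicator id s ≤ s := by
      have : (Set.Ici (1 : ℝ)).indicator id s ≤ s := by
        by_cases hs1 : s ∈ Set.Ici (1 : ℝ)
        · rw [Set.indicator_of_mem hs1, id]
        · rw [Set.indicator_of_notMem hs1]; linarith
      rcases hb₁ with rfl | ⟨rfl, -⟩
      · linarith
      · linarith
    have h3 : (Set.Icc (-1 : ℝ) 0).indicator (fun _ => (1 : ℝ)) s = 0 :=
      Set.indicator_of_notMem (fun hm => by linarith [hm.2]) _
    rw [h3]
    have h4 : 0 ≤ x ^ 2 * psiDeriv2 μ L x * s :=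
      mul_nonneg (by positivity) (hx.le.trans hs')
    have h5 : 0 ≤ (max x 1) ^ 2 * errorSize μ L * ((1 + |s|) ^ 4 * Real.exp (τ * |s|)) := by
      positivity
    linarith

lemma refConvDeriv_mul_le (h : CenteredKernel p τ) (hμ : 0 ≤ μ) (hμ1 : μ ≤ 1) (hμτ : μ ≤ τ)
    (hL : 0 < L) (hc : 0 ≤ c) (hu : errorSize μ L * errorMoment p τ ≤ upperMoment p)
    (hl : errorSize μ L * errorMoment p τ ≤ c * Real.exp (-1) * leftMass p) {x : ℝ} (hx : 0 < x) :
    refConvDeriv p μ L x * refDensity μ L x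
      ≤ refConv p μ L x * (refDensityDeriv μ L x + c * refDensity μ L x) := by
  obtain ⟨b₁, b₂, hb₁, hb₂, hle⟩ : ∃ b₁ b₂ : ℝ, (b₁ = 0 ∨ b₁ = 1 ∧ x ≤ 1) ∧
      (b₂ = 0 ∨ b₂ = c * Real.exp (-1) * x ^ 2) ∧
      (max x 1) ^ 2 * errorSize μ L * errorMoment p τ - b₁ * upperMoment p - b₂ * leftMass p
        ≤ 0 := by
    rcases le_total x 1 with h1 | h1
    · refine ⟨1, 0, Or.inr ⟨rfl, h1⟩, Or.inl rfl, ?_⟩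
      rw [max_eq_right h1]
      linarith
    · refine ⟨0, _, Or.inl rfl, Or.inr rfl, ?_⟩
      rw [max_eq_left h1]
      nlinarith [mul_le_mul_of_nonneg_left hl (sq_nonneg x)]
  have i1 := (h.integrable_mul_refDensityDeriv hμ hL x).mul_const (refDensity μ L x)
  have i2 := (h.integrable_mul_refDensity hμ hL x).mul_const
    (refDensityDeriv μ L x + c * refDensity μ L x)
  have j1 := h.integrable_mul_id.const_mul (1 + x ^ 2 * psiDeriv2 μ L x)
  have j2 := h.integrable.const_mul ((max x 1) ^ 2 * errorSize μ L)
  have j3 := h.integrable_mul_indicator_upper.const_mul b₁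
  have j4 := h.integrable_mul_indicator_left.const_mul b₂
  rw [← sub_nonpos, refConvDeriv, refConv, ← integral_mul_const, ← integral_mul_const,
    ← integral_sub i1 i2]
  have hmono := integral_mono (i1.sub i2)
    ((((j1.add j2).sub j3).sub j4).const_mul (Real.exp (-(2 * psi μ L x)))) (fun s => by
      refine le_trans (le_of_eq ?_) (wronskian_bound h hμ hμ1 hμτ hL hc hx hb₁ hb₂ s)
      simp only [Pi.sub_apply]
      ring)
  refine hmono.trans ?_
  rw [integral_const_mul]
  refine mul_nonpos_of_nonneg_of_nonpos (Real.exp_nonneg _) ?_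
  rw [integral_sub' ((j1.add j2).sub j3) j4, integral_sub' (j1.add j2) j3, integral_add' j1 j2,
    integral_const_mul, integral_const_mul, integral_const_mul, integral_const_mul, h.mean_zero]
  unfold errorMoment upperMoment leftMass at hle
  linarith

lemma refConv_nonneg (h : CenteredKernel p τ) (x : ℝ) : 0 ≤ refConv p μ L x :=
  integral_nonneg fun s => mul_nonneg (h.pos s).le (refDensity_nonneg _)

lemma refConv_pos (h : CenteredKernel p τ) (hμ : 0 ≤ μ) (hL : 0 < L) (x : ℝ) :
    0 < refConv p μ L x := by
  unfold refConv
  refine (integral_pos_iff_support_of_nonneg (fun s => mul_nonneg (h.pos s).le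
    (refDensity_nonneg _)) (h.integrable_mul_refDensity hμ hL x)).2 ?_
  refine lt_of_lt_of_le ?_ (measure_mono (s := Set.Iio x) fun s hs => ?_)
  · simp
  · exact mul_ne_zero (h.pos s).ne' (refDensity_pos (sub_pos.2 hs)).ne'

/-- One step of the walk followed by the area tilt makes the reference density smaller in the
likelihood ratio order. -/
lemma exp_mul_refConv_le (h : CenteredKernel p τ) (hμ : 0 ≤ μ) (hμ1 : μ ≤ 1) (hμτ : μ ≤ τ)
    (hL : 0 < L) (hc : 0 ≤ c) (hu : errorSize μ L * errorMoment p τ ≤ upperMoment p)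
    (hl : errorSize μ L * errorMoment p τ ≤ c * Real.exp (-1) * leftMass p) {x y : ℝ}
    (hx : 0 ≤ x) (hxy : x ≤ y) :
    Real.exp (-(c * y)) * refConv p μ L y * refDensity μ L x
      ≤ Real.exp (-(c * x)) * refConv p μ L x * refDensity μ L y := by
  rcases hx.eq_or_lt with rfl | hx
  · rw [refDensity_of_nonpos le_rfl, mul_zero]
    exact mul_nonneg (mul_nonneg (Real.exp_nonneg _) (h.refConv_nonneg _)) (refDensity_nonneg _)
  have hder : ∀ z, 0 < z → HasDerivAt
      (fun z => Real.exp (-(c * z)) * refConv p μ L z / refDensity μ L z)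
      (Real.exp (-(c * z)) * (refConvDeriv p μ L z * refDensity μ L z
        - refConv p μ L z * (refDensityDeriv μ L z + c * refDensity μ L z))
        / refDensity μ L z ^ 2) z := fun z hz => by
    have he : HasDerivAt (fun z => Real.exp (-(c * z))) (Real.exp (-(c * z)) * -(c * 1)) z :=
      ((hasDerivAt_id z).const_mul c).neg.exp
    refine ((he.mul (h.hasDerivAt_refConv hμ hL z)).div (hasDerivAt_refDensity hL hz.ne')
      (refDensity_pos hz).ne').congr_deriv ?_
    congr 1
    simp only [Pi.mul_apply]
    ring
  have hanti : AntitoneOn (fun z => Real.exp (-(c * z)) * refConv p μ L z / refDensity μ L z)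
      (Set.Ioi 0) := by
    refine antitoneOn_of_deriv_nonpos (convex_Ioi 0)
      (fun z hz => (hder z hz).continuousAt.continuousWithinAt) (fun z hz => ?_) fun z hz => ?_
    · rw [interior_Ioi] at hz
      exact (hder z hz).differentiableAt.differentiableWithinAt
    · rw [interior_Ioi] at hz
      rw [(hder z hz).deriv]
      refine div_nonpos_of_nonpos_of_nonneg (mul_nonpos_of_nonneg_of_nonpos (Real.exp_nonneg _)
        (sub_nonpos.2 ?_)) (sq_nonneg _)
      exact h.refConvDeriv_mul_le hμ hμ1 hμτ hL hc hu hl hz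
  have := hanti (Set.mem_Ioi.2 hx) (Set.mem_Ioi.2 (hx.trans_le hxy)) hxy
  exact (div_le_div_iff₀ (refDensity_pos (hx.trans_le hxy)) (refDensity_pos hx)).1 this

end CenteredKernel

lemma CenteredKernel.neg {p : ℝ → ℝ} {τ : ℝ} (h : CenteredKernel p τ) :
    CenteredKernel (fun s => p (-s)) τ where
  continuous := h.continuous.comp continuous_neg
  pos s := h.pos (-s)
  order_pos := h.order_pos
  integrable := by simpa only [abs_neg] using h.integrable.comp_neg
  mean_zero := by
    have h1 := integral_neg_eq_self (fun s => p s * s) volume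
    simp only [mul_neg, integral_neg] at h1
    rw [h.mean_zero] at h1
    linarith

lemma one_add_abs_pow_mul_exp_le {τ t : ℝ} (hτ : 0 < τ) (hτ1 : τ ≤ 1) (ht : 5 * τ ≤ t) (s : ℝ) :
    (1 + |s|) ^ 4 * Real.exp (τ * |s|)
      ≤ (τ⁻¹) ^ 4 * (Real.exp (t * s) + Real.exp (-t * s)) := by
  have h0 := abs_nonneg s
  have h1 : 1 + |s| ≤ τ⁻¹ * Real.exp (τ * |s|) := by
    rw [← div_eq_inv_mul, le_div_iff₀ hτ]
    nlinarith [Real.add_one_le_exp (τ * |s|)]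
  have h2 : Real.exp (t * |s|) ≤ Real.exp (t * s) + Real.exp (-t * s) := by
    rcases abs_choice s with h | h <;> rw [h]
    · linarith [Real.exp_pos (-t * s)]
    · rw [mul_neg, ← neg_mul]
      linarith [Real.exp_pos (t * s)]
  calc (1 + |s|) ^ 4 * Real.exp (τ * |s|)
      ≤ (τ⁻¹ * Real.exp (τ * |s|)) ^ 4 * Real.exp (τ * |s|) := by gcongr
    _ = (τ⁻¹) ^ 4 * Real.exp (5 * τ * |s|) := by
      rw [mul_pow, ← Real.exp_nat_mul, mul_assoc, ← Real.exp_add]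
      push_cast
      ring_nf
    _ ≤ (τ⁻¹) ^ 4 * Real.exp (t * |s|) := by gcongr
    _ ≤ _ := by gcongr

lemma RWAssumptions.continuous {H : ℝ → ℝ} (hH : RWAssumptions H) : Continuous H :=
  continuousOn_univ.1 (hH.convex.continuousOn isOpen_univ)

lemma RWAssumptions.exists_centeredKernel {H : ℝ → ℝ} (hH : RWAssumptions H) :
    ∃ τ, CenteredKernel (fun s => Real.exp (-(H s))) τ := by
  obtain ⟨t, ht, hi⟩ := hH.mgf
  have hτ : 0 < min 1 (t / 5) := by positivity
  have hcont : Continuous fun s => Real.exp (-(H s)) := Real.continuous_exp.comp hH.continuous.neg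
  refine ⟨min 1 (t / 5), hcont, fun s => Real.exp_pos _, hτ, ?_, ?_⟩
  · have h1 := (hi t (abs_of_pos ht).le).add (hi (-t) (by rw [abs_neg, abs_of_pos ht]))
    refine (h1.const_mul ((min 1 (t / 5))⁻¹ ^ 4)).mono'
      (hcont.mul (by fun_prop)).aestronglyMeasurable (Filter.Eventually.of_forall fun s => ?_)
    rw [Real.norm_of_nonneg (by positivity)]
    have := one_add_abs_pow_mul_exp_le hτ (min_le_left _ _)
      (show 5 * min 1 (t / 5) ≤ t by linarith [min_le_right 1 (t / 5)]) s
    refine (mul_le_mul_of_nonneg_left this (Real.exp_nonneg (-(H s)))).trans (le_of_eq ?_)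
    simp only [Pi.add_apply]
    ring
  · rw [← hH.mean_zero]
    exact integral_congr_ae (Filter.Eventually.of_forall fun s => mul_comm _ _)

section domination

variable {p : ℝ → ℝ} {τ μ L a c : ℝ}

lemma convOp_refDensity (h : CenteredKernel p τ) (hμ : 0 ≤ μ) (hL : 0 < L) (x : ℝ) :
    convOp (fun s => ENNReal.ofReal (p s)) (fun y => ENNReal.ofReal (refDensity μ L (y - a))) x
      = ENNReal.ofReal (refConv p μ L (x - a)) := by
  have hint : Integrable fun y => p (x - y) * refDensity μ L (y - a) := by
    have := (h.integrable_mul_refDensity hμ hL (x - a)).comp_sub_left x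
    refine this.congr (Filter.Eventually.of_forall fun y => ?_)
    simp only
    ring_nf
  unfold convOp refConv
  rw [← integral_sub_left_eq_self _ volume x]
  simp only [← ENNReal.ofReal_mul (h.pos _).le]
  rw [← ofReal_integral_eq_lintegral_ofReal hint (Filter.Eventually.of_forall fun y =>
    mul_nonneg (h.pos _).le (refDensity_nonneg _))]
  congr 1
  refine integral_congr_ae (Filter.Eventually.of_forall fun y => ?_)
  simp only
  ring_nf

lemma siteWeight_of_nonneg {y : ℝ} (hy : 0 ≤ y) :
    siteWeight c y = ENNReal.ofReal (Real.exp (-(c * y))) := if_pos hy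

lemma lt_of_ofReal_refDensity_ne_zero {x : ℝ}
    (hx : ENNReal.ofReal (refDensity μ L (x - a)) ≠ 0) : a < x := by
  by_contra hxa
  exact hx (by rw [refDensity_of_nonpos (by linarith), ENNReal.ofReal_zero])

lemma lrLe_convOp_refDensity (h : CenteredKernel p τ) (hμ : 0 ≤ μ) (hμ1 : μ ≤ 1) (hμτ : μ ≤ τ)
    (hL : 0 < L) (hc : 0 ≤ c) (ha : 0 ≤ a)
    (hu : errorSize μ L * errorMoment p τ ≤ upperMoment p)
    (hl : errorSize μ L * errorMoment p τ ≤ c * Real.exp (-1) * leftMass p) :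
    LRLe (fun x => siteWeight c x * convOp (fun s => ENNReal.ofReal (p s))
      (fun y => ENNReal.ofReal (refDensity μ L (y - a))) x)
      (fun y => ENNReal.ofReal (refDensity μ L (y - a))) := by
  intro x y hxy
  rcases le_or_gt x a with hxa | hax
  · simp [refDensity_of_nonpos (sub_nonpos.2 hxa)]
  have key := h.exp_mul_refConv_le hμ hμ1 hμτ hL hc hu hl (sub_pos.2 hax).le
    (sub_le_sub_right hxy a)
  have e : ∀ z, Real.exp (-(c * z)) = Real.exp (-(c * a)) * Real.exp (-(c * (z - a))) := by
    intro z
    rw [← Real.exp_add]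
    ring_nf
  simp only [convOp_refDensity h hμ hL]
  rw [siteWeight_of_nonneg (by linarith), siteWeight_of_nonneg (by linarith),
    ← ENNReal.ofReal_mul (Real.exp_nonneg _), ← ENNReal.ofReal_mul (Real.exp_nonneg _),
    ← ENNReal.ofReal_mul (mul_nonneg (Real.exp_nonneg _) (h.refConv_nonneg _)),
    ← ENNReal.ofReal_mul (mul_nonneg (Real.exp_nonneg _) (h.refConv_nonneg _)), e x, e y]
  refine ENNReal.ofReal_le_ofReal ?_
  simp only [mul_assoc] at key ⊢
  exact mul_le_mul_of_nonneg_left key (Real.exp_nonneg _)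

lemma siteWeight_mul_convOp_ne (h : CenteredKernel p τ) (hμ : 0 ≤ μ) (hL : 0 < L) (ha : 0 ≤ a)
    {x y : ℝ} (hxy : x ≤ y) (hx : ENNReal.ofReal (refDensity μ L (x - a)) ≠ 0) :
    siteWeight c y * convOp (fun s => ENNReal.ofReal (p s))
        (fun y => ENNReal.ofReal (refDensity μ L (y - a))) y ≠ 0 ∧
      siteWeight c y * convOp (fun s => ENNReal.ofReal (p s))
        (fun y => ENNReal.ofReal (refDensity μ L (y - a))) y ≠ ∞ := by
  have hax := lt_of_ofReal_refDensity_ne_zero hx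
  rw [convOp_refDensity h hμ hL, siteWeight_of_nonneg (by linarith)]
  exact ⟨mul_ne_zero (ENNReal.ofReal_pos.2 (Real.exp_pos _)).ne'
    (ENNReal.ofReal_pos.2 (h.refConv_pos hμ hL _)).ne',
    ENNReal.mul_ne_top ENNReal.ofReal_ne_top ENNReal.ofReal_ne_top⟩

end domination

lemma ConvexOn.add_le_add_of_le {H : ℝ → ℝ} (hH : ConvexOn ℝ Set.univ H) {w d e : ℝ} (hd : 0 ≤ d)
    (he : 0 ≤ e) : H (w + d) + H (w + e) ≤ H w + H (w + d + e) := by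
  rcases (add_nonneg hd he).eq_or_lt with h0 | h0
  · obtain rfl : d = 0 := by linarith
    obtain rfl : e = 0 := by linarith
    simp
  have key : ∀ r s : ℝ, 0 ≤ r → 0 ≤ s → r + s = d + e →
      H (w + r) ≤ s / (d + e) * H w + r / (d + e) * H (w + d + e) := fun r s hr hs hrs => by
    have := hH.2 (Set.mem_univ w) (Set.mem_univ (w + d + e))
      (div_nonneg hs h0.le) (div_nonneg hr h0.le) (by rw [← add_div, add_comm, hrs, div_self h0.ne'])
    refine le_trans (le_of_eq (congrArg H ?_)) this
    simp only [smul_eq_mul]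
    have hs' : s = d + e - r := by linarith
    rw [hs']
    field_simp
    ring
  have h1 := key d e hd he rfl
  have h2 := key e d he hd (add_comm _ _)
  have h3 : e / (d + e) = 1 - d / (d + e) := by
    field_simp
    ring
  rw [h3] at h1 h2
  linarith

lemma walkKernel_totallyPositive {H : ℝ → ℝ} (hH : ConvexOn ℝ Set.univ H) {x y s t : ℝ}
    (hxy : x ≤ y) (hst : s ≤ t) :
    walkKernel H (y - s) * walkKernel H (x - t) ≤ walkKernel H (x - s) * walkKernel H (y - t) := by
  have h := hH.add_le_add_of_le (w := x - t) (sub_nonneg.2 hxy) (sub_nonneg.2 hst)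
  rw [show x - t + (y - x) = y - t by ring, show x - t + (t - s) = x - s by ring,
    show y - t + (t - s) = y - s by ring] at h
  unfold walkKernel
  rw [← ENNReal.ofReal_mul (Real.exp_nonneg _), ← ENNReal.ofReal_mul (Real.exp_nonneg _),
    ← Real.exp_add, ← Real.exp_add]
  exact ENNReal.ofReal_le_ofReal (Real.exp_le_exp.2 (by linarith))

lemma measurable_siteWeight (c : ℝ) : Measurable (siteWeight c) := by
  unfold siteWeight
  exact Measurable.ite measurableSet_Ici (by fun_prop) measurable_const

lemma dominatingDensity_refDensity {H : ℝ → ℝ} (hH : RWAssumptions H) {τ μ L a c : ℝ}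
    (h : CenteredKernel (fun s => Real.exp (-(H s))) τ) (hμ : 0 ≤ μ) (hμ1 : μ ≤ 1) (hμτ : μ ≤ τ)
    (hL : 0 < L) (hc : 0 ≤ c) (ha : 0 ≤ a)
    (hu : errorSize μ L * errorMoment (fun s => Real.exp (-(H s))) τ
      ≤ upperMoment fun s => Real.exp (-(H s)))
    (hl : errorSize μ L * errorMoment (fun s => Real.exp (-(H s))) τ
      ≤ c * Real.exp (-1) * leftMass fun s => Real.exp (-(H s)))
    (hu' : errorSize μ L * errorMoment (fun s => Real.exp (-(H (-s)))) τ
      ≤ upperMoment fun s => Real.exp (-(H (-s))))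
    (hl' : errorSize μ L * errorMoment (fun s => Real.exp (-(H (-s)))) τ
      ≤ c * Real.exp (-1) * leftMass fun s => Real.exp (-(H (-s)))) :
    DominatingDensity (walkKernel H) (siteWeight c)
      (fun y => ENNReal.ofReal (refDensity μ L (y - a))) where
  measurable_kernel := ENNReal.measurable_ofReal.comp h.continuous.measurable
  measurable_weight := measurable_siteWeight c
  measurable_density := ENNReal.measurable_ofReal.comp
    ((continuous_refDensity hL).measurable.comp (measurable_id.sub_const a))
  totallyPositive x y s t hxy hst := walkKernel_totallyPositive hH.convex hxy hst
  forward := lrLe_convOp_refDensity h hμ hμ1 hμτ hL hc ha hu hl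
  backward := lrLe_convOp_refDensity h.neg hμ hμ1 hμτ hL hc ha hu' hl'
  forward_pos x y hxy hx := siteWeight_mul_convOp_ne h hμ hL ha hxy hx
  backward_pos x y hxy hx := siteWeight_mul_convOp_ne h.neg hμ hL ha hxy hx
  weight_anti x y hxy hx := by
    have hax := lt_of_ofReal_refDensity_ne_zero hx
    rw [siteWeight_of_nonneg (by linarith), siteWeight_of_nonneg (by linarith)]
    exact ENNReal.ofReal_le_ofReal (Real.exp_le_exp.2
      (neg_le_neg (mul_le_mul_of_nonneg_left hxy hc)))

lemma setLIntegral_Ioi_sub (f : ℝ → ℝ≥0∞) (a b : ℝ) :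
    ∫⁻ y in Set.Ioi (a + b), f (y - a) = ∫⁻ x in Set.Ioi b, f x := by
  rw [← lintegral_indicator measurableSet_Ioi, ← lintegral_indicator measurableSet_Ioi,
    ← lintegral_sub_right_eq_self ((Set.Ioi b).indicator f) a]
  refine lintegral_congr fun y => ?_
  simp only [Set.indicator, Set.mem_Ioi, lt_sub_iff_add_lt']

lemma setLIntegral_Iic_sub (f : ℝ → ℝ≥0∞) (a b : ℝ) :
    ∫⁻ y in Set.Iic (a + b), f (y - a) = ∫⁻ x in Set.Iic b, f x := by
  rw [← lintegral_indicator measurableSet_Iic, ← lintegral_indicator measurableSet_Iic,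
    ← lintegral_sub_right_eq_self ((Set.Iic b).indicator f) a]
  refine lintegral_congr fun y => ?_
  simp only [Set.indicator, Set.mem_Iic, sub_le_iff_le_add']

section tail

variable {μ L : ℝ}

lemma mul_le_psi (hμ : 0 ≤ μ) (hL : 0 < L) {x : ℝ} (hx : L ≤ x) : μ * x / 10 ≤ psi μ L x := by
  have h1 := le_psi_sub hμ hL (half_pos hL).le (show L / 2 ≤ x by linarith)
  have h2 : psiDeriv μ L (L / 2) = μ / 5 := by
    unfold psiDeriv
    field_simp
    ring
  rw [h2] at h1
  have h3 := psi_nonneg hμ hL (half_pos hL).le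
  nlinarith [mul_le_mul_of_nonneg_left hx hμ]

lemma setLIntegral_refDensity_tail_le (hμ : 0 < μ) (hL : 0 < L) :
    ∫⁻ x in Set.Ioi L, ENNReal.ofReal (refDensity μ L x) * ENNReal.ofReal (refDensity μ L x)
      ≤ ENNReal.ofReal (2 * (10 / μ) ^ 3 * Real.exp (-(μ * L / 10))) := by
  have hr : 0 < μ / 10 := by positivity
  have hval : ∫ x in Set.Ioi (0 : ℝ), x ^ 2 * Real.exp (-(μ / 10 * x)) = 2 * (10 / μ) ^ 3 := by
    have h := Real.integral_rpow_mul_exp_neg_mul_Ioi (a := 3) (by norm_num) hr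
    have hG : Real.Gamma 3 = 2 := by
      rw [show (3 : ℝ) = ((2 : ℕ) : ℝ) + 1 by norm_num, Real.Gamma_nat_eq_factorial]
      norm_num
    rw [hG] at h
    norm_num at h
    rw [h]
    ring
  have hint : IntegrableOn (fun x : ℝ => x ^ 2 * Real.exp (-(μ / 10 * x))) (Set.Ioi 0) :=
    Integrable.of_integral_ne_zero (by rw [hval]; positivity)
  calc ∫⁻ x in Set.Ioi L, ENNReal.ofReal (refDensity μ L x) * ENNReal.ofReal (refDensity μ L x)
      ≤ ∫⁻ x in Set.Ioi L, ENNReal.ofReal (Real.exp (-(μ * L / 10)))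
          * ENNReal.ofReal (x ^ 2 * Real.exp (-(μ / 10 * x))) := by
        refine setLIntegral_mono' measurableSet_Ioi fun x hx => ?_
        have hxL : L ≤ x := le_of_lt hx
        rw [← ENNReal.ofReal_mul (refDensity_nonneg _), ← ENNReal.ofReal_mul (Real.exp_nonneg _)]
        refine ENNReal.ofReal_le_ofReal ?_
        rw [refDensity_of_nonneg (hL.le.trans hxL)]
        have h1 := mul_le_psi hμ.le hL hxL
        have h2 : Real.exp (-(psi μ L x)) * Real.exp (-(psi μ L x))
            ≤ Real.exp (-(μ * L / 10)) * Real.exp (-(μ / 10 * x)) := by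
          rw [← Real.exp_add, ← Real.exp_add]
          refine Real.exp_le_exp.2 ?_
          nlinarith [mul_le_mul_of_nonneg_left hxL hμ.le]
        calc _ = x ^ 2 * (Real.exp (-(psi μ L x)) * Real.exp (-(psi μ L x))) := by ring
          _ ≤ x ^ 2 * (Real.exp (-(μ * L / 10)) * Real.exp (-(μ / 10 * x))) := by gcongr
          _ = _ := by ring
    _ = ENNReal.ofReal (Real.exp (-(μ * L / 10)))
          * ∫⁻ x in Set.Ioi L, ENNReal.ofReal (x ^ 2 * Real.exp (-(μ / 10 * x))) :=
        lintegral_const_mul' _ _ ENNReal.ofReal_ne_top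
    _ ≤ ENNReal.ofReal (Real.exp (-(μ * L / 10)))
          * ∫⁻ x in Set.Ioi 0, ENNReal.ofReal (x ^ 2 * Real.exp (-(μ / 10 * x))) := by
        gcongr
    _ = ENNReal.ofReal (2 * (10 / μ) ^ 3 * Real.exp (-(μ * L / 10))) := by
        rw [← ofReal_integral_eq_lintegral_ofReal hint
          (Filter.Eventually.of_forall fun x => by positivity), hval,
          ← ENNReal.ofReal_mul (Real.exp_nonneg _), mul_comm]

lemma le_setLIntegral_refDensity (hμ : 0 ≤ μ) (hL : 0 < L) {h : ℝ} (h0 : 0 < h) (hhL : h ≤ L)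
    (hs : μ / L ^ 2 * h ^ 3 ≤ 1) :
    ENNReal.ofReal ((h / 2) ^ 3 * Real.exp (-2))
      ≤ ∫⁻ x in Set.Iic L,
        ENNReal.ofReal (refDensity μ L x) * ENNReal.ofReal (refDensity μ L x) := by
  have hψ : ∀ x, 0 ≤ x → x ≤ h → psi μ L x ≤ 1 := fun x hx hxh => by
    have h1 := psi_sub_le hμ hL le_rfl h0.le
    rw [psi_zero, sub_zero, sub_zero] at h1
    have h2 := mul_le_mul_of_nonneg_right (psiDeriv_le_sq hμ hL h) h0.le
    have h3 := psi_monotone hμ hL hxh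
    linarith
  calc ENNReal.ofReal ((h / 2) ^ 3 * Real.exp (-2))
      = ENNReal.ofReal ((h / 2) ^ 2 * Real.exp (-2)) * volume (Set.Icc (h / 2) h) := by
        rw [Real.volume_Icc, ← ENNReal.ofReal_mul (by positivity)]
        ring_nf
    _ = ∫⁻ _ in Set.Icc (h / 2) h, ENNReal.ofReal ((h / 2) ^ 2 * Real.exp (-2)) := by
        rw [setLIntegral_const]
    _ ≤ ∫⁻ x in Set.Icc (h / 2) h,
          ENNReal.ofReal (refDensity μ L x) * ENNReal.ofReal (refDensity μ L x) := by
        refine setLIntegral_mono' measurableSet_Icc fun x hx => ?_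
        have hx0 : 0 ≤ x := (half_pos h0).le.trans hx.1
        rw [← ENNReal.ofReal_mul (refDensity_nonneg _)]
        refine ENNReal.ofReal_le_ofReal ?_
        rw [refDensity_of_nonneg hx0]
        have h1 : Real.exp (-1) ≤ Real.exp (-(psi μ L x)) :=
          Real.exp_le_exp.2 (neg_le_neg (hψ x hx0 hx.2))
        have h2 : Real.exp (-2) = Real.exp (-1) * Real.exp (-1) := by
          rw [← Real.exp_add]; norm_num
        calc _ = (h / 2 * Real.exp (-1)) * (h / 2 * Real.exp (-1)) := by rw [h2]; ring
          _ ≤ _ := by gcongr <;> exact hx.1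
    _ ≤ _ := lintegral_mono_set fun x hx => hx.2.trans hhL

lemma setLIntegral_refDensity_ne_top (hμ : 0 ≤ μ) (hL : 0 < L) :
    ∫⁻ x in Set.Iic L,
      ENNReal.ofReal (refDensity μ L x) * ENNReal.ofReal (refDensity μ L x) ≠ ∞ := by
  have hle : ∫⁻ x in Set.Iic L,
      ENNReal.ofReal (refDensity μ L x) * ENNReal.ofReal (refDensity μ L x)
      ≤ ENNReal.ofReal (L * L) * volume (Set.Icc 0 L) := by
    rw [← setLIntegral_const, ← lintegral_indicator measurableSet_Iic,
      ← lintegral_indicator measurableSet_Icc]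
    refine lintegral_mono fun x => ?_
    by_cases hx : x ∈ Set.Icc 0 L
    · rw [Set.indicator_of_mem (show x ∈ Set.Iic L from hx.2), Set.indicator_of_mem hx,
        ← ENNReal.ofReal_mul (refDensity_nonneg _)]
      have h1 : refDensity μ L x ≤ L := (refDensity_le_abs hμ hL x).trans
        (by rw [abs_of_nonneg hx.1]; exact hx.2)
      exact ENNReal.ofReal_le_ofReal (mul_le_mul h1 h1 (refDensity_nonneg _) hL.le)
    · rw [Set.indicator_of_notMem hx]
      by_cases hxL : x ∈ Set.Iic L
      · have hx0 : x ≤ 0 := le_of_not_ge fun h0 => hx ⟨h0, hxL⟩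
        rw [Set.indicator_of_mem hxL, refDensity_of_nonpos hx0]
        simp
      · rw [Set.indicator_of_notMem hxL]
  refine ne_top_of_le_ne_top ?_ hle
  rw [Real.volume_Icc]
  exact ENNReal.mul_ne_top ENNReal.ofReal_ne_top ENNReal.ofReal_ne_top

end tail

lemma probOf_tiltedMeasure_tail_le {H : ℝ → ℝ} (hH : Measurable H) {g : ℝ → ℝ≥0∞} {u z a c : ℝ}
    {b : ℝ≥0∞} (D : DominatingDensity (walkKernel H) (siteWeight (c / 2)) g)
    (hu : ∀ x < u, g x = 0) (hz : ∀ x < z, g x = 0)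
    (hb : ∫⁻ x in Set.Ioi a, g x * g x ≤ b * ∫⁻ x in Set.Iic a, g x * g x)
    (h0 : ∫⁻ x in Set.Iic a, g x * g x ≠ 0) (htop : ∫⁻ x in Set.Iic a, g x * g x ≠ ∞)
    (n : ℕ) (i : Fin n) :
    probOf (tiltedMeasure H u z n c (fun _ => 0)) {q | a < q i} ≤ b := by
  unfold probOf
  rw [tiltedMeasure_tail hH, tiltedMeasure_univ hH, siteWeight_half_mul_self]
  refine ENNReal.div_le_of_le_mul ?_
  rw [mul_left_comm]
  gcongr
  exact D.chainTail_le hu hz hb h0 htop n i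

lemma Hlam_pow_three {lam N : ℝ} (hlam : 0 < lam) (hN : 0 < N) : Hlam lam N ^ 3 = N / lam := by
  unfold Hlam
  rw [mul_pow, ← Real.rpow_natCast, ← Real.rpow_natCast, ← Real.rpow_mul hlam.le,
    ← Real.rpow_mul hN.le]
  norm_num
  rw [Real.rpow_neg_one, inv_mul_eq_div]

lemma exists_pos_mul_le {a b : ℝ} (ha : 0 < a) (hb : 0 < b) :
    ∃ ε > 0, ∀ δ : ℝ, 0 ≤ δ → δ ≤ ε → δ * a ≤ b :=
  ⟨b / a, div_pos hb ha, fun _ _ hδ => (le_div_iff₀ ha).1 hδ⟩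

/-- Small parameters for which all errors are dominated by the area tilt. -/
lemma CenteredKernel.exists_errorSize_bounds {p : ℝ → ℝ} {τ : ℝ} (h : CenteredKernel p τ) :
    ∃ ε > 0, ∀ δ c μ L : ℝ, 0 ≤ δ → δ ≤ ε → 0 ≤ c → c ≤ 1 → errorSize μ L ≤ 4 * δ * c →
      errorSize μ L * errorMoment p τ ≤ upperMoment p ∧
      errorSize μ L * errorMoment p τ ≤ c / 2 * Real.exp (-1) * leftMass p := by
  obtain ⟨ε₁, h₁, H₁⟩ := exists_pos_mul_le (a := 4 * errorMoment p τ)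
    (by linarith [h.errorMoment_pos]) h.upperMoment_pos
  obtain ⟨ε₂, h₂, H₂⟩ := exists_pos_mul_le (a := 4 * errorMoment p τ)
    (b := Real.exp (-1) * leftMass p / 2) (by linarith [h.errorMoment_pos])
    (half_pos (mul_pos (Real.exp_pos _) h.leftMass_pos))
  refine ⟨min ε₁ ε₂, lt_min h₁ h₂, fun δ c μ L hδ hδε hc hc1 hK => ?_⟩
  have hM := h.errorMoment_pos
  have k1 := H₁ δ hδ (hδε.trans (min_le_left _ _))
  have k2 := mul_le_mul_of_nonneg_left (H₂ δ hδ (hδε.trans (min_le_right _ _))) hc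
  have k3 := mul_le_mul_of_nonneg_right hK hM.le
  have k4 : 0 ≤ δ * (4 * errorMoment p τ) := by positivity
  have k5 := mul_le_mul_of_nonneg_left hc1 k4
  constructor <;> linarith

lemma errorSize_le {ε r h : ℝ} (hε : 0 ≤ ε) (hε1 : ε ≤ 1) (hr : 1 ≤ r) (hh : 0 < h) :
    errorSize (ε * r / h) (r ^ 2 * h) ≤ 4 * ε * (1 / h ^ 3) := by
  have hr0 : 0 < r := by linarith
  have e1 : ε * r / h / (r ^ 2 * h) ^ 2 = ε * (1 / h ^ 3) * (1 / r ^ 3) := by field_simp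
  have e2 : (ε * r / h) ^ 2 / (r ^ 2 * h) = ε * (1 / h ^ 3) * ε := by field_simp
  have h1 : 1 / r ^ 3 ≤ 1 := (div_le_one (by positivity)).2 (one_le_pow₀ hr)
  have hb : 0 ≤ ε * (1 / h ^ 3) := by positivity
  unfold errorSize
  rw [e1, e2]
  linarith [mul_le_mul_of_nonneg_left h1 hb, mul_le_mul_of_nonneg_left hε1 hb]

lemma tail_ratio_le {ε r h a : ℝ} (hε : 0 < ε) (hε1 : ε ≤ 1) (hr : 1 ≤ r) (hh : 0 < h) :
    ∫⁻ y in Set.Ioi (a + r ^ 2 * h),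
        ENNReal.ofReal (refDensity (ε * r / h) (r ^ 2 * h) (y - a))
          * ENNReal.ofReal (refDensity (ε * r / h) (r ^ 2 * h) (y - a))
      ≤ ENNReal.ofReal (16 * Real.exp 2 * (10 / ε) ^ 3 * Real.exp (-(ε / 10 * r ^ 3)))
        * ∫⁻ y in Set.Iic (a + r ^ 2 * h),
          ENNReal.ofReal (refDensity (ε * r / h) (r ^ 2 * h) (y - a))
            * ENNReal.ofReal (refDensity (ε * r / h) (r ^ 2 * h) (y - a)) ∧
    ∫⁻ y in Set.Iic (a + r ^ 2 * h),
        ENNReal.ofReal (refDensity (ε * r / h) (r ^ 2 * h) (y - a))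
          * ENNReal.ofReal (refDensity (ε * r / h) (r ^ 2 * h) (y - a)) ≠ 0 ∧
    ∫⁻ y in Set.Iic (a + r ^ 2 * h),
        ENNReal.ofReal (refDensity (ε * r / h) (r ^ 2 * h) (y - a))
          * ENNReal.ofReal (refDensity (ε * r / h) (r ^ 2 * h) (y - a)) ≠ ∞ := by
  have hr0 : 0 < r := by linarith
  have hμ : 0 < ε * r / h := by positivity
  have hL : 0 < r ^ 2 * h := by positivity
  have hhL : h ≤ r ^ 2 * h := le_mul_of_one_le_left hh.le (one_le_pow₀ hr)
  have hs : ε * r / h / (r ^ 2 * h) ^ 2 * h ^ 3 ≤ 1 := by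
    have e1 : ε * r / h / (r ^ 2 * h) ^ 2 * h ^ 3 = ε / r ^ 3 := by field_simp
    rw [e1, div_le_one (by positivity)]
    exact hε1.trans (one_le_pow₀ hr)
  have hlow := le_setLIntegral_refDensity hμ.le hL hh hhL hs
  rw [setLIntegral_Ioi_sub (fun x => ENNReal.ofReal (refDensity (ε * r / h) (r ^ 2 * h) x)
      * ENNReal.ofReal (refDensity (ε * r / h) (r ^ 2 * h) x)),
    setLIntegral_Iic_sub (fun x => ENNReal.ofReal (refDensity (ε * r / h) (r ^ 2 * h) x)
      * ENNReal.ofReal (refDensity (ε * r / h) (r ^ 2 * h) x))]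
  refine ⟨(setLIntegral_refDensity_tail_le hμ hL).trans (le_trans ?_ (mul_le_mul_right hlow _)),
    (lt_of_lt_of_le (ENNReal.ofReal_pos.2 (by positivity)) hlow).ne',
    setLIntegral_refDensity_ne_top hμ.le hL⟩
  rw [← ENNReal.ofReal_mul (by positivity)]
  refine ENNReal.ofReal_le_ofReal ?_
  have e1 : ε * r / h * (r ^ 2 * h) / 10 = ε / 10 * r ^ 3 := by field_simp
  have e2 : Real.exp 2 * Real.exp (-2) = 1 := by rw [← Real.exp_add]; simp
  have e3 : 16 * Real.exp 2 * (10 / ε) ^ 3 * Real.exp (-(ε / 10 * r ^ 3))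
      * ((h / 2) ^ 3 * Real.exp (-2))
      = 2 * (10 / ε) ^ 3 * Real.exp (-(ε / 10 * r ^ 3)) * h ^ 3
        * (Real.exp 2 * Real.exp (-2)) := by ring
  rw [e1, e3, e2, mul_one, mul_right_comm _ _ (h ^ 3)]
  refine mul_le_mul_of_nonneg_right ?_ (Real.exp_nonneg _)
  rw [mul_assoc, ← mul_pow]
  gcongr
  rw [div_le_iff₀ hμ]
  have e4 : 10 / ε * h * (ε * r / h) = 10 * r := by field_simp
  rw [e4]
  linarith

/-- One-point upper tail with Tracy–Widom exponent `3/2`: there exist universal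
constants `c, C > 0` and `N₀` such that for any `N ≥ N₀`, `λ ∈ (0,N)`,
`R ∈ [0, H_λ²]`, interval `I ⊆ ⟦-N,N⟧` (of `n+1` steps) with `|I| ≥ H_λ²`,
boundary conditions `u, v ≤ A·H_λ` with `A > 0`, and any `t ∈ I`, the
`λ`-area-tilted bridge above a floor at `0` satisfies
`P(X(t) > (R+A)·H_λ) ≤ C exp(-c R^{3/2})`. -/
theorem one_point_upper_tail (H : ℝ → ℝ) (hH : RWAssumptions H) :
    ∃ c > 0, ∃ C > 0, ∃ N₀ : ℕ, ∀ N : ℕ, N₀ ≤ N →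
      ∀ lam : ℝ, 0 < lam → lam < N → ∀ R : ℝ, 0 ≤ R → R ≤ (Hlam lam N) ^ 2 →
      ∀ n : ℕ, (Hlam lam N) ^ 2 ≤ (n : ℝ) + 1 → (n : ℝ) + 1 ≤ 2 * N →
      ∀ A : ℝ, 0 < A → ∀ u v : ℝ, u ≤ A * Hlam lam N → v ≤ A * Hlam lam N →
      ∀ t : ℕ, t ≤ n + 1 →
        probOf (tiltedMeasure H u v n (lam / N) (fun _ => 0))
            {q | (R + A) * Hlam lam N < pathOf u v n q t}
          ≤ ENNReal.ofReal (C * Real.exp (-(c * R ^ ((3 : ℝ) / 2)))) := by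
  obtain ⟨τ, hp⟩ := hH.exists_centeredKernel
  obtain ⟨ε₁, hε₁, H₁⟩ := hp.exists_errorSize_bounds
  obtain ⟨ε₂, hε₂, H₂⟩ := hp.neg.exists_errorSize_bounds
  obtain ⟨ε, hε, hε1, hετ, hεε₁, hεε₂⟩ :
      ∃ ε > 0, ε ≤ 1 ∧ ε ≤ τ ∧ ε ≤ ε₁ ∧ ε ≤ ε₂ := by
    refine ⟨min (min 1 τ) (min ε₁ ε₂), ?_, ?_, ?_, ?_, ?_⟩
    · exact lt_min (lt_min one_pos hp.order_pos) (lt_min hε₁ hε₂)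
    all_goals simp
  refine ⟨ε / 10, by positivity, 16 * Real.exp 2 * (10 / ε) ^ 3 + Real.exp 1, by positivity, 0,
    fun N _ lam hlam hlamN R hR0 hRh n _ _ A hA u v hu hv t ht => ?_⟩
  have hN : (0 : ℝ) < N := hlam.trans hlamN
  have hh3 : Hlam lam N ^ 3 = N / lam := Hlam_pow_three hlam hN
  have hh : 0 < Hlam lam N := by unfold Hlam; positivity
  set h := Hlam lam N
  have hc : lam / N = 1 / h ^ 3 := by rw [hh3, one_div_div]
  have hc0 : 0 ≤ lam / N := by positivity
  have hc1 : lam / N ≤ 1 := (div_le_one hN).2 hlamN.le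
  have ha : 0 < A * h := mul_pos hA hh
  rcases lt_or_ge R 1 with hR1 | hR1
  · refine ENNReal.div_le_of_le_mul ?_
    have h1 : R ^ ((3 : ℝ) / 2) ≤ 1 := Real.rpow_le_one hR0 hR1.le (by norm_num)
    have h2 : Real.exp (-1) ≤ Real.exp (-(ε / 10 * R ^ ((3 : ℝ) / 2))) := by
      refine Real.exp_le_exp.2 (neg_le_neg ?_)
      nlinarith [Real.rpow_nonneg hR0 ((3 : ℝ) / 2)]
    have h3 : Real.exp 1 * Real.exp (-1) = 1 := by rw [← Real.exp_add]; simp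
    have h4 : (1 : ℝ) ≤ (16 * Real.exp 2 * (10 / ε) ^ 3 + Real.exp 1)
        * Real.exp (-(ε / 10 * R ^ ((3 : ℝ) / 2))) := by
      have h5 : 0 ≤ 16 * Real.exp 2 * (10 / ε) ^ 3 := by positivity
      exact h3.symm.trans_le
        (mul_le_mul (le_add_of_nonneg_left h5) h2 (Real.exp_nonneg _) (by positivity))
    exact (measure_mono (Set.subset_univ _)).trans
      (le_mul_of_one_le_left' (ENNReal.one_le_ofReal.2 h4))
  have hempty : ∀ w ≤ A * h, ¬ (R + A) * h < w := fun w hw hlt => by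
    nlinarith [mul_nonneg hR0 hh.le]
  by_cases htn : 1 ≤ t ∧ t ≤ n
  swap
  · have hE : {q : Fin n → ℝ | (R + A) * h < pathOf u v n q t} = ∅ := by
      refine Set.eq_empty_of_forall_notMem fun q hq => ?_
      simp only [Set.mem_ofPred_eq, pathOf, dif_neg htn] at hq
      split_ifs at hq
      exacts [hempty u hu hq, hempty v hv hq]
    simp [probOf, hE]
  have hE : {q : Fin n → ℝ | (R + A) * h < pathOf u v n q t}
      = {q | A * h + √R ^ 2 * h < q ⟨t - 1, by omega⟩} := by
    ext q
    simp only [Set.mem_ofPred_eq, pathOf, dif_pos htn, Real.sq_sqrt hR0]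
    rw [add_mul, add_comm]
  have hr : 1 ≤ √R := Real.one_le_sqrt.2 hR1
  have hrh : √R ≤ h := Real.sqrt_le_iff.2 ⟨hh.le, hRh⟩
  have hr3 : R ^ ((3 : ℝ) / 2) = √R ^ 3 := by
    rw [Real.sqrt_eq_rpow, ← Real.rpow_natCast, ← Real.rpow_mul hR0]
    norm_num
  have hμ : 0 ≤ ε * √R / h := by positivity
  have hμε : ε * √R / h ≤ ε := by
    rw [div_le_iff₀ hh]
    gcongr
  have hK := errorSize_le hε.le hε1 hr hh
  rw [← hc] at hK
  obtain ⟨hu₁, hl₁⟩ := H₁ ε (lam / N) _ _ hε.le hεε₁ hc0 hc1 hK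
  obtain ⟨hu₂, hl₂⟩ := H₂ ε (lam / N) _ _ hε.le hεε₂ hc0 hc1 hK
  have D := dominatingDensity_refDensity (a := A * h) hH hp hμ (hμε.trans hε1) (hμε.trans hετ)
    (by positivity) (half_pos (div_pos hlam hN)).le ha.le hu₁ hl₁ hu₂ hl₂
  have hzero : ∀ w ≤ A * h, ∀ x < w,
      ENNReal.ofReal (refDensity (ε * √R / h) (√R ^ 2 * h) (x - A * h)) = 0 := fun w hw x hx => by
    rw [refDensity_of_nonpos (by linarith), ENNReal.ofReal_zero]
  obtain ⟨hb, h0, htop⟩ := tail_ratio_le (a := A * h) hε hε1 hr hh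
  rw [hE, hr3]
  refine (probOf_tiltedMeasure_tail_le hH.continuous.measurable D (hzero u hu) (hzero v hv) hb h0
    htop n _).trans (ENNReal.ofReal_le_ofReal ?_)
  gcongr
  linarith [Real.exp_pos 1]
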